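/- arXiv:1004.2445 — 10 statements merged into one kernel-verified Lean document; each statement's English description precedes it below -/
import Mathlib

section
/- Let a > 0 and b > 0 be real numbers, and let f : [0,∞) → ℝ be a continuous function such that the function x ↦ f((a·x − b/x)²) is integrable on (0,∞) and the function y ↦ f(y²) is integrable on (0,∞). Then ∫₀^∞ f((a·x − b/x)²) dx = (1/a) · ∫₀^∞ f(y²) dy. -/
open MeasureTheory

theorem image_const_div_Ioi_zero {k : ℝ} (hk : 0 < k) :
    (fun x : ℝ => k / x) '' Set.Ioi 0 = Set.Ioi 0 := by
  ext y
  constructor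
  · rintro ⟨x, hx, rfl⟩
    exact div_pos hk hx
  · intro hy
    exact ⟨k / y, div_pos hk hy, div_div_cancel₀ hk.ne'⟩

theorem injOn_const_div_Ioi_zero {k : ℝ} (hk : 0 < k) :
    Set.InjOn (fun x : ℝ => k / x) (Set.Ioi 0) := by
  intro x _ y _ hxy
  rw [← div_div_cancel₀ (b := x) hk.ne', ← div_div_cancel₀ (b := y) hk.ne']
  exact congrArg (k / ·) hxy

theorem hasDerivAt_const_div (k : ℝ) {x : ℝ} (hx : x ≠ 0) :
    HasDerivAt (fun x : ℝ => k / x) (-(k / x ^ 2)) x := by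
  simpa [div_eq_mul_inv] using (hasDerivAt_inv hx).const_mul k

theorem image_mul_sub_div_Ioi_zero {a b : ℝ} (ha : 0 < a) (hb : 0 < b) :
    (fun x : ℝ => a * x - b / x) '' Set.Ioi 0 = Set.univ := by
  refine Set.eq_univ_of_forall fun y => ?_
  have hD : 0 ≤ y ^ 2 + 4 * a * b := by positivity
  have hs := Real.sq_sqrt hD
  have hlt : |y| < √(y ^ 2 + 4 * a * b) := by
    rw [← Real.sqrt_sq_eq_abs]
    exact Real.sqrt_lt_sqrt (sq_nonneg y) (lt_add_of_pos_right _ (by positivity))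
  set s := √(y ^ 2 + 4 * a * b)
  have hpos : 0 < y + s := by linarith [neg_abs_le y]
  refine ⟨(y + s) / (2 * a), Set.mem_Ioi.2 (by positivity), ?_⟩
  simp only
  field_simp
  linear_combination hs

theorem injOn_mul_sub_div_Ioi_zero {a b : ℝ} (ha : 0 < a) (hb : 0 < b) :
    Set.InjOn (fun x : ℝ => a * x - b / x) (Set.Ioi 0) := by
  refine StrictMonoOn.injOn fun x hx y _ hxy => ?_
  exact sub_lt_sub (mul_lt_mul_of_pos_left hxy ha) (div_lt_div_of_pos_left hb hx hxy)

theorem cauchy_schlomilch (a b : ℝ) (ha : 0 < a) (hb : 0 < b) (f : ℝ → ℝ)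
    (hf : ContinuousOn f (Set.Ici 0))
    (h1 : IntegrableOn (fun x : ℝ => f ((a * x - b / x) ^ 2)) (Set.Ioi 0))
    (h2 : IntegrableOn (fun y : ℝ => f (y ^ 2)) (Set.Ioi 0)) :
    ∫ x in Set.Ioi (0 : ℝ), f ((a * x - b / x) ^ 2) =
      (1 / a) * ∫ y in Set.Ioi (0 : ℝ), f (y ^ 2) := by
  set G : ℝ → ℝ := fun x => f ((a * x - b / x) ^ 2) with hG
  have hk : 0 < b / a := div_pos hb ha
  have hderiv : ∀ x ∈ Set.Ioi (0 : ℝ), HasDerivWithinAt (fun x : ℝ => b / a / x)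
      (-(b / a / x ^ 2)) (Set.Ioi 0) x :=
    fun x hx => (hasDerivAt_const_div _ (ne_of_gt hx)).hasDerivWithinAt
  have hreflect : Set.EqOn (fun x : ℝ => |-(b / a / x ^ 2)| • G (b / a / x))
      (fun x => a⁻¹ * (b / x ^ 2 * G x)) (Set.Ioi 0) := by
    intro x hx
    have hx : 0 < x := hx
    have hGx : G (b / a / x) = G x := by
      simp only [hG]
      congr 1
      field_simp
      ring
    simp only [hGx, abs_neg, abs_of_pos (show 0 < b / a / x ^ 2 by positivity), smul_eq_mul]
    field_simp
  have hint : IntegrableOn (fun x => b / x ^ 2 * G x) (Set.Ioi 0) := by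
    have h := h1
    rw [← image_const_div_Ioi_zero hk, integrableOn_image_iff_integrableOn_abs_deriv_smul
      measurableSet_Ioi hderiv (injOn_const_div_Ioi_zero hk),
      integrableOn_congr_fun hreflect measurableSet_Ioi] at h
    refine (h.const_mul a).congr (ae_of_all _ fun x => ?_)
    exact mul_inv_cancel_left₀ ha.ne' _
  have hsymm : ∫ x in Set.Ioi 0, G x = a⁻¹ * ∫ x in Set.Ioi 0, b / x ^ 2 * G x := by
    have h := integral_image_eq_integral_abs_deriv_smul measurableSet_Ioi hderiv
      (injOn_const_div_Ioi_zero hk) G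
    rwa [image_const_div_Ioi_zero hk, setIntegral_congr_fun measurableSet_Ioi hreflect,
      integral_const_mul] at h
  have hline : ∫ y, f (y ^ 2) = ∫ x in Set.Ioi 0, (a * G x + b / x ^ 2 * G x) := by
    have h := integral_image_eq_integral_abs_deriv_smul (s := Set.Ioi (0 : ℝ))
      (f := fun x => a * x - b / x) (f' := fun x => a + b / x ^ 2) measurableSet_Ioi
      (fun x hx => by
        have hd := ((hasDerivAt_id' x).const_mul a).fun_sub
          (hasDerivAt_const_div b (ne_of_gt hx))
        rw [mul_one, sub_neg_eq_add] at hd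
        exact hd.hasDerivWithinAt)
      (injOn_mul_sub_div_Ioi_zero ha hb) (fun y => f (y ^ 2))
    rw [image_mul_sub_div_Ioi_zero ha hb, setIntegral_univ] at h
    rw [h]
    refine setIntegral_congr_fun measurableSet_Ioi fun x hx => ?_
    have hx : 0 < x := hx
    simp only [abs_of_pos (show 0 < a + b / x ^ 2 by positivity), smul_eq_mul, hG]
    ring
  have heven : ∫ y, f (y ^ 2) = 2 * ∫ y in Set.Ioi (0 : ℝ), f (y ^ 2) := by
    rw [← integral_comp_abs (f := fun y => f (y ^ 2))]
    simp only [sq_abs]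
  rw [integral_add (h1.const_mul a) hint, integral_const_mul, heven] at hline
  rw [inv_mul_eq_div, eq_div_iff ha.ne'] at hsymm
  rw [one_div_mul_eq_div, eq_div_iff ha.ne']
  linarith
end

section
/- For every natural number n ≥ 1, ∫₀^∞ [(x² + x⁻⁶)·(x⁴ − x² + 1) − 1] · exp(−(x⁷ − x⁻⁷)^{2n}) dx = Γ(1/(2n)) / (14n). -/
open MeasureTheory

lemma injOn_pow_sub_inv_pow {k : ℕ} (hk : k ≠ 0) :
    Set.InjOn (fun x : ℝ => x ^ k - (x ^ k)⁻¹) (Set.Ioi 0) := by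
  refine StrictMonoOn.injOn fun x hx y hy hxy => ?_
  have hx : 0 < x := hx
  have h : x ^ k < y ^ k := pow_lt_pow_left₀ hxy hx.le hk
  exact sub_lt_sub h (inv_strictAnti₀ (pow_pos hx k) h)

lemma image_pow_sub_inv_pow {k : ℕ} (hk : k ≠ 0) :
    (fun x : ℝ => x ^ k - (x ^ k)⁻¹) '' Set.Ioi 0 = Set.univ := by
  refine Set.eq_univ_of_forall fun u => ?_
  set s := Real.sqrt (u ^ 2 + 4)
  have hs : s ^ 2 = u ^ 2 + 4 := Real.sq_sqrt (by positivity)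
  have ht : 0 < (u + s) / 2 := by
    have : |u| < s := Real.lt_sqrt_of_sq_lt (by rw [sq_abs]; linarith)
    linarith [neg_abs_le u]
  refine ⟨((u + s) / 2) ^ ((k : ℝ)⁻¹), Real.rpow_pos_of_pos ht _, ?_⟩
  simp only [Real.rpow_inv_natCast_pow ht.le hk]
  have : u + s ≠ 0 := by linarith
  field_simp
  linear_combination hs

lemma hasDerivAt_pow_sub_inv_pow (k : ℕ) {x : ℝ} (hx : x ≠ 0) :
    HasDerivAt (fun x : ℝ => x ^ k - (x ^ k)⁻¹)
      (k * (x ^ k + (x ^ k)⁻¹) / x) x := by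
  rcases Nat.eq_zero_or_pos k with rfl | hk
  · simpa using hasDerivAt_const x (0 : ℝ)
  refine ((hasDerivAt_pow k x).sub ((hasDerivAt_pow k x).inv (pow_ne_zero k hx))).congr_deriv ?_
  obtain ⟨m, rfl⟩ := Nat.exists_eq_add_of_le' hk
  rw [Nat.add_sub_cancel]
  field_simp
  ring

lemma exp_neg_pow_even_eq (n : ℕ) (x : ℝ) :
    Real.exp (-x ^ (2 * n)) = Real.exp (-|x| ^ ((2 * n : ℕ) : ℝ)) := by
  rw [Real.rpow_natCast, pow_mul, pow_mul, sq_abs]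

lemma integral_exp_neg_pow_even {n : ℕ} (hn : 1 ≤ n) :
    ∫ x : ℝ, Real.exp (-x ^ (2 * n)) = Real.Gamma (1 / (2 * n)) / n := by
  have hn' : (0 : ℝ) < n := by exact_mod_cast hn
  simp_rw [exp_neg_pow_even_eq]
  rw [integral_comp_abs (f := fun x => Real.exp (-x ^ ((2 * n : ℕ) : ℝ))),
    integral_exp_neg_rpow (by push_cast; positivity), Real.Gamma_add_one (by push_cast; positivity)]
  push_cast
  field_simp

lemma integrable_exp_neg_pow_even {n : ℕ} (hn : 1 ≤ n) :
    Integrable fun x : ℝ => Real.exp (-x ^ (2 * n)) := by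
  have hn' : (0 : ℝ) < n := by exact_mod_cast hn
  refine Integrable.of_integral_ne_zero ?_
  rw [integral_exp_neg_pow_even hn]
  exact (div_pos (Real.Gamma_pos_of_pos (by positivity)) hn').ne'

lemma abs_deriv_smul_pow_sub_inv_pow (k : ℕ) (g : ℝ → ℝ) {x : ℝ} (hx : 0 < x) :
    |k * (x ^ k + (x ^ k)⁻¹) / x| • g (x ^ k - (x ^ k)⁻¹) =
      k * ((x ^ k + (x ^ k)⁻¹) / x * g (x ^ k - (x ^ k)⁻¹)) := by
  rw [abs_of_nonneg (by positivity), smul_eq_mul]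
  ring

lemma integral_comp_pow_sub_inv_pow {k : ℕ} (hk : k ≠ 0) (g : ℝ → ℝ) :
    k * ∫ x in Set.Ioi (0 : ℝ), (x ^ k + (x ^ k)⁻¹) / x * g (x ^ k - (x ^ k)⁻¹) =
      ∫ u, g u := by
  have h := integral_image_eq_integral_abs_deriv_smul measurableSet_Ioi
    (fun x (hx : x ∈ Set.Ioi (0 : ℝ)) =>
      (hasDerivAt_pow_sub_inv_pow k (ne_of_gt hx)).hasDerivWithinAt)
    (injOn_pow_sub_inv_pow hk) g
  rw [image_pow_sub_inv_pow hk, setIntegral_univ] at h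
  rw [h, ← integral_const_mul]
  exact setIntegral_congr_fun measurableSet_Ioi fun x hx =>
    (abs_deriv_smul_pow_sub_inv_pow k g hx).symm

lemma integrableOn_comp_pow_sub_inv_pow {k : ℕ} (hk : k ≠ 0) {g : ℝ → ℝ} (hg : Integrable g) :
    IntegrableOn (fun x => (x ^ k + (x ^ k)⁻¹) / x * g (x ^ k - (x ^ k)⁻¹)) (Set.Ioi 0) := by
  have h := integrableOn_image_iff_integrableOn_abs_deriv_smul measurableSet_Ioi
    (fun x (hx : x ∈ Set.Ioi (0 : ℝ)) =>
      (hasDerivAt_pow_sub_inv_pow k (ne_of_gt hx)).hasDerivWithinAt)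
    (injOn_pow_sub_inv_pow hk) g
  rw [image_pow_sub_inv_pow hk, integrableOn_univ] at h
  have h' := (h.1 hg).congr_fun (fun x hx => abs_deriv_smul_pow_sub_inv_pow k g hx)
    measurableSet_Ioi
  simpa [IntegrableOn, integrable_const_mul_iff, hk] using h'

lemma abs_neg_one_mul_rpow_smul_comp_rpow_neg_one (g : ℝ → ℝ) {x : ℝ} (hx : 0 < x) :
    (|(-1 : ℝ)| * x ^ (-1 - 1 : ℝ)) • g (x ^ (-1 : ℝ)) = (x ^ 2)⁻¹ * g x⁻¹ := by
  have h : x ^ (-1 - 1 : ℝ) = (x ^ 2)⁻¹ := by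
    rw [show (-1 - 1 : ℝ) = -((2 : ℕ) : ℝ) by norm_num, Real.rpow_neg hx.le, Real.rpow_natCast]
  simp [h, Real.rpow_neg_one]

lemma integral_comp_inv_Ioi (g : ℝ → ℝ) :
    ∫ x in Set.Ioi (0 : ℝ), (x ^ 2)⁻¹ * g x⁻¹ = ∫ x in Set.Ioi (0 : ℝ), g x := by
  rw [← integral_comp_rpow_Ioi g (p := -1) (by norm_num)]
  exact setIntegral_congr_fun measurableSet_Ioi fun x hx =>
    (abs_neg_one_mul_rpow_smul_comp_rpow_neg_one g hx).symm

lemma integrableOn_comp_inv_Ioi {g : ℝ → ℝ} (hg : IntegrableOn g (Set.Ioi 0)) :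
    IntegrableOn (fun x => (x ^ 2)⁻¹ * g x⁻¹) (Set.Ioi 0) :=
  ((integrableOn_Ioi_comp_rpow_iff g (p := -1) (by norm_num)).2 hg).congr_fun
    (fun _ hx => abs_neg_one_mul_rpow_smul_comp_rpow_neg_one g hx) measurableSet_Ioi

theorem integral_example_gamma (n : ℕ) (hn : 1 ≤ n) :
    ∫ x in Set.Ioi (0 : ℝ),
      ((x ^ 2 + (x ^ 6)⁻¹) * (x ^ 4 - x ^ 2 + 1) - 1) *
        Real.exp (-(x ^ 7 - (x ^ 7)⁻¹) ^ (2 * n)) =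
      Real.Gamma (1 / (2 * n)) / (14 * n) := by
  set w : ℝ → ℝ := fun x => (x ^ 7 + (x ^ 7)⁻¹) / x * Real.exp (-(x ^ 7 - (x ^ 7)⁻¹) ^ (2 * n))
    with hw
  set f : ℝ → ℝ := fun x => ((x ^ 2 + (x ^ 6)⁻¹) * (x ^ 4 - x ^ 2 + 1) - 1) *
    Real.exp (-(x ^ 7 - (x ^ 7)⁻¹) ^ (2 * n)) with hf
  have hw_int : IntegrableOn w (Set.Ioi 0) :=
    integrableOn_comp_pow_sub_inv_pow (by norm_num) (integrable_exp_neg_pow_even hn)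
  have hw_eq : 7 * ∫ x in Set.Ioi (0 : ℝ), w x = Real.Gamma (1 / (2 * n)) / n := by
    rw [← integral_exp_neg_pow_even hn]
    exact_mod_cast integral_comp_pow_sub_inv_pow (k := 7) (by norm_num)
      fun u => Real.exp (-u ^ (2 * n))
  have hfw : ∀ x ∈ Set.Ioi (0 : ℝ), f x = x ^ 2 / (x ^ 2 + 1) * w x := by
    intro x hx
    have hx : 0 < x := hx
    simp only [hf, hw, ← mul_assoc]
    congr 1
    field_simp
    ring
  have hf_int : IntegrableOn f (Set.Ioi 0) := by
    refine Integrable.mono' hw_int (by fun_prop) ?_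
    filter_upwards [ae_restrict_mem measurableSet_Ioi] with x hx
    have hx' : 0 < x := hx
    have hw0 : 0 ≤ w x := by positivity
    rw [hfw x hx, Real.norm_of_nonneg (by positivity)]
    exact mul_le_of_le_one_left hw0 ((div_le_one (by positivity)).2 (by linarith))
  have hsym : ∀ x ∈ Set.Ioi (0 : ℝ), f x + (x ^ 2)⁻¹ * f x⁻¹ = w x := by
    intro x hx
    have hx' : 0 < x := hx
    have hE : (x⁻¹ ^ 7 - (x⁻¹ ^ 7)⁻¹) ^ (2 * n) = (x ^ 7 - (x ^ 7)⁻¹) ^ (2 * n) := by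
      rw [inv_pow, inv_inv, ← neg_sub, Even.neg_pow (even_two_mul n)]
    simp only [hf, hw, hE, ← mul_assoc, ← add_mul]
    congr 1
    field_simp
    ring
  have hsum : 2 * ∫ x in Set.Ioi (0 : ℝ), f x = ∫ x in Set.Ioi (0 : ℝ), w x := by
    rw [← setIntegral_congr_fun measurableSet_Ioi hsym,
      integral_add hf_int (integrableOn_comp_inv_Ioi hf_int), integral_comp_inv_Ioi, two_mul]
  have h14 : ∫ x in Set.Ioi (0 : ℝ), f x = Real.Gamma (1 / (2 * n)) / n / 14 := by
    linarith
  rw [h14, div_div, mul_comm (n : ℝ) 14]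
end

section
/- For every real number c > 0, ∫_{−∞}^{∞} exp(u − c·sinh²(u)) du = √(π/c). -/
open MeasureTheory

/-- The substitution `x = sinh u` over the whole real line preserves integrability. -/
theorem integrable_cosh_mul_comp_sinh {g : ℝ → ℝ} (hg : Integrable g) :
    Integrable fun u : ℝ => Real.cosh u * g (Real.sinh u) := by
  have h := integrableOn_image_iff_integrableOn_abs_deriv_smul (s := Set.univ) MeasurableSet.univ
    (fun x _ => (Real.hasDerivAt_sinh x).hasDerivWithinAt) Real.sinh_injective.injOn g
  rw [Set.image_univ, Real.sinh_surjective.range_eq] at h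
  simpa [integrableOn_univ, abs_of_pos (Real.cosh_pos _)] using h.1 hg.integrableOn

/-- The substitution `x = sinh u` over the whole real line. -/
theorem integral_cosh_mul_comp_sinh (g : ℝ → ℝ) :
    ∫ u : ℝ, Real.cosh u * g (Real.sinh u) = ∫ x, g x := by
  have h := integral_image_eq_integral_abs_deriv_smul (s := Set.univ) MeasurableSet.univ
    (fun x _ => (Real.hasDerivAt_sinh x).hasDerivWithinAt) Real.sinh_injective.injOn g
  rw [Set.image_univ, Real.sinh_surjective.range_eq] at h
  simpa [abs_of_pos (Real.cosh_pos _)] using h.symm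

theorem abs_sinh_le_cosh (u : ℝ) : |Real.sinh u| ≤ Real.cosh u :=
  abs_le_of_sq_le_sq (by linarith [Real.cosh_sq u]) (Real.cosh_pos u).le

theorem integral_exp_sub_sinh_sq (c : ℝ) (hc : 0 < c) :
    ∫ u : ℝ, Real.exp (u - c * Real.sinh u ^ 2) = Real.sqrt (Real.pi / c) := by
  have hcosh := integrable_cosh_mul_comp_sinh (integrable_exp_neg_mul_sq hc)
  have hsinh : Integrable fun u : ℝ => Real.sinh u * Real.exp (-c * Real.sinh u ^ 2) := by
    refine hcosh.mono' (by fun_prop) (.of_forall fun u => ?_)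
    rw [norm_mul, Real.norm_eq_abs, Real.norm_eq_abs, Real.abs_exp]
    gcongr
    exact abs_sinh_le_cosh u
  have hodd : ∫ u : ℝ, Real.sinh u * Real.exp (-c * Real.sinh u ^ 2) = 0 := by
    have h := integral_neg_eq_self (fun u : ℝ => Real.sinh u * Real.exp (-c * Real.sinh u ^ 2))
      volume
    simp only [Real.sinh_neg, neg_sq, neg_mul, integral_neg] at h ⊢
    linarith
  calc
    _ = ∫ u : ℝ, (Real.cosh u * Real.exp (-c * Real.sinh u ^ 2) +
          Real.sinh u * Real.exp (-c * Real.sinh u ^ 2)) := by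
      congr 1 with u
      rw [← add_mul, Real.cosh_add_sinh, ← Real.exp_add, neg_mul, sub_eq_add_neg]
    _ = _ := by
      rw [integral_add hcosh hsinh, hodd, add_zero,
        integral_cosh_mul_comp_sinh fun x => Real.exp (-c * x ^ 2), integral_gaussian]
end

section
/- Let a > −1 and b > 0 be real numbers and set a⋆ = b/(2(1+a)). Let f : [0, a⋆] → ℝ be a continuous function such that x ↦ f(b·x²/(x⁴+2a·x²+1)) is integrable on (0,∞) and t ↦ f(a⋆·t)/(t·√(t(1−t))) is integrable on (0,1). Then ∫₀^∞ f(b·x²/(x⁴+2a·x²+1)) dx = (√b/(2·√(a⋆))) · ∫₀¹ f(a⋆·t)/(t·√(t(1−t))) dt. -/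
open MeasureTheory

/-- If `g` is invariant under `x ↦ x⁻¹`, its integral over the half-line folds onto `(1, ∞)`. -/
theorem integral_Ioi_zero_eq_integral_Ioi_one_of_inv_invariant {g : ℝ → ℝ}
    (hg : ∀ x, 0 < x → g x⁻¹ = g x) (hint : IntegrableOn g (Set.Ioi 0)) :
    ∫ x in Set.Ioi (0 : ℝ), g x = ∫ x in Set.Ioi (1 : ℝ), (1 + (x ^ 2)⁻¹) * g x := by
  have himg : (fun x : ℝ => x⁻¹) '' Set.Ioi 1 = Set.Ioo 0 1 := by
    ext y
    constructor
    · rintro ⟨x, hx, rfl⟩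
      have hx : 1 < x := hx
      exact ⟨inv_pos.2 (by linarith), inv_lt_one_of_one_lt₀ hx⟩
    · rintro ⟨h0, h1⟩
      exact ⟨y⁻¹, (one_lt_inv₀ h0).2 h1, inv_inv y⟩
  have hderiv : ∀ x ∈ Set.Ioi (1 : ℝ),
      HasDerivWithinAt (fun x : ℝ => x⁻¹) (-(x ^ 2)⁻¹) (Set.Ioi 1) x := fun x hx =>
    (hasDerivAt_inv (zero_lt_one.trans hx).ne').hasDerivWithinAt
  have hinj : Set.InjOn (fun x : ℝ => x⁻¹) (Set.Ioi 1) := inv_injective.injOn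
  have hsmul : Set.EqOn (fun x : ℝ => |(-(x ^ 2)⁻¹)| • g x⁻¹) (fun x => (x ^ 2)⁻¹ * g x)
      (Set.Ioi 1) := by
    intro x hx
    have hx0 : 0 < x := zero_lt_one.trans hx
    simp only [abs_neg, smul_eq_mul, hg x hx0]
    rw [abs_of_pos (by positivity)]
  have h01 : IntegrableOn g (Set.Ioo 0 1) := hint.mono_set Set.Ioo_subset_Ioi_self
  have h1 : IntegrableOn g (Set.Ioi 1) := hint.mono_set (Set.Ioi_subset_Ioi zero_le_one)
  have hchange := integral_image_eq_integral_abs_deriv_smul measurableSet_Ioi hderiv hinj g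
  rw [himg, setIntegral_congr_fun measurableSet_Ioi hsmul] at hchange
  have hint' : IntegrableOn (fun x : ℝ => (x ^ 2)⁻¹ * g x) (Set.Ioi 1) := by
    rw [← integrableOn_congr_fun hsmul measurableSet_Ioi,
      ← integrableOn_image_iff_integrableOn_abs_deriv_smul measurableSet_Ioi hderiv hinj, himg]
    exact h01
  have hsplit : ∫ x in Set.Ioi (0 : ℝ), g x
      = (∫ x in Set.Ioo (0 : ℝ) 1, g x) + ∫ x in Set.Ioi (1 : ℝ), g x := by
    rw [← integral_Ioc_eq_integral_Ioo, ← setIntegral_union (Set.Ioc_disjoint_Ioi le_rfl)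
      measurableSet_Ioi (hint.mono_set Set.Ioc_subset_Ioi_self) h1,
      Set.Ioc_union_Ioi_eq_Ioi zero_le_one]
  rw [hsplit, hchange, add_comm, ← integral_add h1 hint']
  exact integral_congr_ae (.of_forall fun x => by ring)

/-- The substitution `u = x - x⁻¹` from `(1, ∞)` onto `(0, ∞)`. -/
theorem integral_Ioi_comp_sub_inv (h : ℝ → ℝ) :
    ∫ x in Set.Ioi (1 : ℝ), (1 + (x ^ 2)⁻¹) * h (x - x⁻¹) = ∫ u in Set.Ioi (0 : ℝ), h u := by
  have himg : (fun x : ℝ => x - x⁻¹) '' Set.Ioi 1 = Set.Ioi 0 := by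
    ext u
    constructor
    · rintro ⟨x, hx, rfl⟩
      have hx : 1 < x := hx
      exact sub_pos.2 ((inv_lt_one_of_one_lt₀ hx).trans hx)
    · intro hu
      have hu : 0 < u := hu
      have hs : √(u ^ 2 + 4) ^ 2 = u ^ 2 + 4 := Real.sq_sqrt (by positivity)
      have h2 : 2 < √(u ^ 2 + 4) := Real.lt_sqrt_of_sq_lt (by nlinarith)
      refine ⟨(u + √(u ^ 2 + 4)) / 2, ?_, ?_⟩
      · simp only [Set.mem_Ioi]; linarith
      · have : u + √(u ^ 2 + 4) ≠ 0 := by positivity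
        simp only
        field_simp
        nlinarith
  have hderiv : ∀ x ∈ Set.Ioi (1 : ℝ),
      HasDerivWithinAt (fun x : ℝ => x - x⁻¹) (1 + (x ^ 2)⁻¹) (Set.Ioi 1) x := fun x hx => by
    have := (hasDerivAt_id x).sub (hasDerivAt_inv (zero_lt_one.trans hx).ne')
    rw [sub_neg_eq_add] at this
    exact this.hasDerivWithinAt
  have hinj : Set.InjOn (fun x : ℝ => x - x⁻¹) (Set.Ioi 1) := by
    refine StrictMonoOn.injOn fun x hx y hy hxy => ?_
    exact sub_lt_sub hxy (inv_strictAnti₀ (zero_lt_one.trans hx) hxy)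
  rw [← himg, integral_image_eq_integral_abs_deriv_smul measurableSet_Ioi hderiv hinj]
  refine setIntegral_congr_fun measurableSet_Ioi fun x _ => ?_
  simp only [smul_eq_mul]
  rw [abs_of_pos (by positivity)]

/-- The substitution `u = √(c (1 - t) / t)` from `(0, 1)` onto `(0, ∞)`. -/
theorem integral_Ioi_comp_inv_sq_add {c : ℝ} (hc : 0 < c) (k : ℝ → ℝ) :
    ∫ u in Set.Ioi (0 : ℝ), k (c / (u ^ 2 + c)) =
      √c / 2 * ∫ t in Set.Ioo (0 : ℝ) 1, k t / (t * √(t * (1 - t))) := by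
  have hpos : ∀ t ∈ Set.Ioo (0 : ℝ) 1, 0 < t⁻¹ - 1 := fun t ht =>
    sub_pos.2 ((one_lt_inv₀ ht.1).2 ht.2)
  have hinv : ∀ t ∈ Set.Ioo (0 : ℝ) 1, c / ((√c * √(t⁻¹ - 1)) ^ 2 + c) = t := fun t ht => by
    have := ht.1
    rw [mul_pow, Real.sq_sqrt hc.le, Real.sq_sqrt (hpos t ht).le]
    field_simp
    ring
  have himg : (fun t : ℝ => √c * √(t⁻¹ - 1)) '' Set.Ioo 0 1 = Set.Ioi 0 := by
    ext u
    constructor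
    · rintro ⟨t, ht, rfl⟩
      exact mul_pos (Real.sqrt_pos.2 hc) (Real.sqrt_pos.2 (hpos t ht))
    · intro hu
      have hu : 0 < u := hu
      refine ⟨c / (u ^ 2 + c), ⟨by positivity, ?_⟩, ?_⟩
      · rw [div_lt_one (by positivity)]
        linarith [pow_pos hu 2]
      · have : c * ((c / (u ^ 2 + c))⁻¹ - 1) = u ^ 2 := by
          field_simp
          ring
        simp only
        rw [← Real.sqrt_mul hc.le, this, Real.sqrt_sq hu.le]
  have hderiv : ∀ t ∈ Set.Ioo (0 : ℝ) 1,
      HasDerivWithinAt (fun t : ℝ => √c * √(t⁻¹ - 1))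
        (√c * (-(t ^ 2)⁻¹ / (2 * √(t⁻¹ - 1)))) (Set.Ioo 0 1) t := fun t ht =>
    ((((hasDerivAt_inv ht.1.ne').sub_const 1).sqrt (hpos t ht).ne').const_mul _).hasDerivWithinAt
  have hinj : Set.InjOn (fun t : ℝ => √c * √(t⁻¹ - 1)) (Set.Ioo 0 1) :=
    Set.LeftInvOn.injOn (f₁' := fun u => c / (u ^ 2 + c)) hinv
  rw [← himg, integral_image_eq_integral_abs_deriv_smul measurableSet_Ioo hderiv hinj,
    ← integral_const_mul]
  refine setIntegral_congr_fun measurableSet_Ioo fun t ht => ?_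
  have ht0 := ht.1
  have hs := Real.sqrt_pos.2 (hpos t ht)
  have hsqrt : √(t * (1 - t)) = t * √(t⁻¹ - 1) := by
    have : t * (1 - t) = t ^ 2 * (t⁻¹ - 1) := by
      field_simp
    rw [this, Real.sqrt_mul (by positivity), Real.sqrt_sq ht0.le]
  simp only [smul_eq_mul]
  rw [hinv t ht, hsqrt, neg_div, mul_neg, abs_neg, abs_of_pos (by positivity)]
  field_simp

theorem cauchy_schlomilch_alternative_form (a b : ℝ) (ha : -1 < a) (hb : 0 < b)
    (f : ℝ → ℝ) (hf : ContinuousOn f (Set.Icc 0 (b / (2 * (1 + a)))))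
    (h1 : IntegrableOn (fun x : ℝ => f (b * x ^ 2 / (x ^ 4 + 2 * a * x ^ 2 + 1)))
      (Set.Ioi 0))
    (h2 : IntegrableOn
      (fun t : ℝ => f (b / (2 * (1 + a)) * t) / (t * Real.sqrt (t * (1 - t))))
      (Set.Ioo 0 1)) :
    ∫ x in Set.Ioi (0 : ℝ), f (b * x ^ 2 / (x ^ 4 + 2 * a * x ^ 2 + 1)) =
      Real.sqrt b / (2 * Real.sqrt (b / (2 * (1 + a)))) *
        ∫ t in Set.Ioo (0 : ℝ) 1,
          f (b / (2 * (1 + a)) * t) / (t * Real.sqrt (t * (1 - t))) := by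
  have hc : 0 < 2 * (1 + a) := by linarith
  have hsub : ∀ x : ℝ, 0 < x → b * x ^ 2 / (x ^ 4 + 2 * a * x ^ 2 + 1)
      = b / (2 * (1 + a)) * (2 * (1 + a) / ((x - x⁻¹) ^ 2 + 2 * (1 + a))) := fun x hx => by
    have hden : x ^ 4 + 2 * a * x ^ 2 + 1 = x ^ 2 * ((x - x⁻¹) ^ 2 + 2 * (1 + a)) := by
      field_simp
      ring
    have : 0 < (x - x⁻¹) ^ 2 + 2 * (1 + a) := by positivity
    rw [hden, div_mul_div_cancel₀ hc.ne', mul_comm b, mul_div_mul_left _ _ (by positivity)]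
  have hconst : √b / (2 * √(b / (2 * (1 + a)))) = √(2 * (1 + a)) / 2 := by
    have := Real.sqrt_pos.2 hb
    have := Real.sqrt_pos.2 hc
    rw [Real.sqrt_div hb.le]
    field_simp
  rw [hconst, ← integral_Ioi_comp_inv_sq_add hc fun t => f (b / (2 * (1 + a)) * t),
    integral_Ioi_zero_eq_integral_Ioi_one_of_inv_invariant (fun x hx => ?_) h1,
    ← integral_Ioi_comp_sub_inv]
  · refine setIntegral_congr_fun measurableSet_Ioi fun x hx => ?_
    rw [hsub x (zero_lt_one.trans hx)]
  · rw [hsub x hx, hsub _ (inv_pos.2 hx), inv_inv, ← neg_sub x, neg_sq]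
end

section
/- Let a > −1 be a real number and set u = 1/(8(1+a)). Let (c_n)_{n≥1} be a sequence of real numbers such that Σ_{n≥1} |c_n| · r^n < ∞ for some real r > 1/(2(1+a)), and define f(x) = Σ_{n=1}^∞ c_n · x^n for |x| ≤ 1/(2(1+a)). Then ∫₀^∞ f(x²/(x⁴+2a·x²+1)) dx = (π / (2^{3/2} · √(1+a))) · Σ_{n=0}^∞ c_{n+1} · binom(2n, n) · u^n, and in particular both the integral and the series on the right converge. -/
open MeasureTheory

/-- The kernel `(w ^ 2 + b)⁻¹ ^ (n + 1)` is integrable over the real line. -/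
lemma integrable_inv_sq_add_pow {b : ℝ} (hb : 0 < b) (n : ℕ) :
    Integrable (fun w : ℝ => (w ^ 2 + b)⁻¹ ^ (n + 1)) := by
  have hpos : ∀ w : ℝ, 0 < w ^ 2 + b := fun w => by positivity
  have hm : 0 < min 1 b := lt_min one_pos hb
  have hcont : Continuous (fun w : ℝ => (w ^ 2 + b)⁻¹ ^ (n + 1)) :=
    (Continuous.inv₀ (by fun_prop) fun w => (hpos w).ne').pow _
  refine (integrable_inv_one_add_sq.const_mul (b⁻¹ ^ n * (min 1 b)⁻¹)).mono'
    hcont.aestronglyMeasurable (Filter.Eventually.of_forall fun w => ?_)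
  have h0 : 0 ≤ (w ^ 2 + b)⁻¹ := (inv_pos.2 (hpos w)).le
  rw [Real.norm_of_nonneg (pow_nonneg h0 _), pow_succ, mul_assoc, ← mul_inv]
  have h1 : (w ^ 2 + b)⁻¹ ≤ b⁻¹ := inv_anti₀ hb (by nlinarith [sq_nonneg w])
  have h2 : (w ^ 2 + b)⁻¹ ≤ (min 1 b * (1 + w ^ 2))⁻¹ := by
    refine inv_anti₀ (by positivity) ?_
    nlinarith [min_le_left 1 b, min_le_right 1 b, sq_nonneg w]
  gcongr

lemma tendsto_mul_inv_sq_add_pow {b : ℝ} (hb : 0 < b) (n : ℕ) {l : Filter ℝ}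
    (hl : Filter.Tendsto (fun w : ℝ => w⁻¹) l (nhds 0)) :
    Filter.Tendsto (fun w : ℝ => w * (w ^ 2 + b)⁻¹ ^ (n + 1)) l (nhds 0) := by
  have h : Filter.Tendsto (fun w : ℝ => b⁻¹ ^ n * |w⁻¹|) l (nhds 0) := by
    simpa using hl.abs.const_mul (b⁻¹ ^ n)
  refine squeeze_zero_norm (fun w => ?_) h
  have h0 : 0 ≤ (w ^ 2 + b)⁻¹ := by positivity
  have h1 : (w ^ 2 + b)⁻¹ ≤ b⁻¹ := inv_anti₀ hb (by nlinarith [sq_nonneg w])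
  have h2 : |w| * (w ^ 2 + b)⁻¹ ≤ |w⁻¹| := by
    rcases eq_or_ne w 0 with rfl | hw
    · simp
    · have hw' : 0 < |w| := abs_pos.2 hw
      rw [abs_inv, ← div_eq_mul_inv, div_le_iff₀ (by positivity), ← sq_abs w,
        inv_mul_eq_div, le_div_iff₀ hw']
      nlinarith
  rw [Real.norm_eq_abs, abs_mul, abs_of_nonneg (pow_nonneg h0 _), pow_succ]
  calc |w| * ((w ^ 2 + b)⁻¹ ^ n * (w ^ 2 + b)⁻¹)
      = (w ^ 2 + b)⁻¹ ^ n * (|w| * (w ^ 2 + b)⁻¹) := by ring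
    _ ≤ b⁻¹ ^ n * |w⁻¹| := by gcongr

lemma integral_inv_sq_add_pow_succ {b : ℝ} (hb : 0 < b) (n : ℕ) :
    2 * (n + 1) * b * ∫ w : ℝ, (w ^ 2 + b)⁻¹ ^ (n + 2) =
      (2 * n + 1) * ∫ w : ℝ, (w ^ 2 + b)⁻¹ ^ (n + 1) := by
  have hderiv : ∀ w : ℝ, HasDerivAt (fun w : ℝ => w * (w ^ 2 + b)⁻¹ ^ (n + 1))
      (2 * (n + 1) * b * (w ^ 2 + b)⁻¹ ^ (n + 2) -
        (2 * n + 1) * (w ^ 2 + b)⁻¹ ^ (n + 1)) w := by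
    intro w
    have hne : w ^ 2 + b ≠ 0 := by positivity
    have h := (hasDerivAt_id w).mul
      (((((hasDerivAt_id w).pow 2).add_const b).inv hne).pow (n + 1))
    refine h.congr_deriv ?_
    simp only [id, Nat.add_sub_cancel, Pi.pow_apply, Pi.inv_apply]
    have hp := inv_mul_cancel₀ hne
    rw [div_eq_mul_inv, ← inv_pow]
    generalize (w ^ 2 + b)⁻¹ = p at hp
    push_cast
    linear_combination (-2 * (n + 1) * p ^ (n + 1)) * hp
  have i1 := (integrable_inv_sq_add_pow hb (n + 1)).const_mul (2 * (n + 1) * b)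
  have i2 := (integrable_inv_sq_add_pow hb n).const_mul (2 * n + 1 : ℝ)
  have h := integral_of_hasDerivAt_of_tendsto hderiv (i1.sub i2)
    (tendsto_mul_inv_sq_add_pow hb n tendsto_inv_atBot_zero)
    (tendsto_mul_inv_sq_add_pow hb n tendsto_inv_atTop_zero)
  rw [integral_sub i1 i2, integral_const_mul, integral_const_mul] at h
  linarith

lemma integral_inv_sq_add {b : ℝ} (hb : 0 < b) :
    ∫ w : ℝ, (w ^ 2 + b)⁻¹ = Real.pi / √b := by
  have h := Measure.integral_comp_div (fun w : ℝ => (1 + w ^ 2)⁻¹) (√b)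
  rw [integral_univ_inv_one_add_sq, abs_of_nonneg (Real.sqrt_nonneg b), smul_eq_mul] at h
  have hs : 0 < √b := Real.sqrt_pos.2 hb
  have hsq : √b ^ 2 = b := Real.sq_sqrt hb.le
  have e : (fun w : ℝ => (w ^ 2 + b)⁻¹) = fun w => b⁻¹ * (1 + (w / √b) ^ 2)⁻¹ := by
    funext w
    rw [div_pow, hsq, ← mul_inv]
    congr 1
    field_simp
    ring
  rw [e, integral_const_mul, h]
  nth_rewrite 1 [← hsq]
  field_simp

lemma integral_inv_sq_add_pow {b : ℝ} (hb : 0 < b) (n : ℕ) :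
    ∫ w : ℝ, (w ^ 2 + b)⁻¹ ^ (n + 1) =
      Real.pi / √b * ((Nat.choose (2 * n) n : ℝ) * (1 / (4 * b)) ^ n) := by
  induction n with
  | zero => simpa using integral_inv_sq_add hb
  | succ n ih =>
    have h := integral_inv_sq_add_pow_succ hb n
    have hc : ((n : ℝ) + 1) * (Nat.choose (2 * (n + 1)) (n + 1) : ℝ) =
        2 * (2 * n + 1) * (Nat.choose (2 * n) n : ℝ) := by
      exact_mod_cast Nat.succ_mul_centralBinom_succ n
    rw [ih] at h
    have hk : (2 * ((n : ℝ) + 1) * b) ≠ 0 := by positivity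
    apply mul_left_cancel₀ hk
    rw [h, pow_succ]
    calc _ = Real.pi / √b * (1 / (4 * b)) ^ n / 2 *
          (2 * (2 * n + 1) * (Nat.choose (2 * n) n : ℝ)) := by ring
      _ = _ := by
        rw [← hc]
        field_simp
        ring

/-- The inverse of the Cauchy–Schlömilch substitution `x ↦ x - 1 / x` on the positive half-line. -/
lemma image_add_sqrt_sq_add_four :
    (fun w : ℝ => (w + √(w ^ 2 + 4)) / 2) '' Set.univ = Set.Ioi 0 := by
  ext x
  simp only [Set.image_univ, Set.mem_range, Set.mem_Ioi]
  constructor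
  · rintro ⟨w, rfl⟩
    have : |w| < √(w ^ 2 + 4) := by
      rw [← Real.sqrt_sq_eq_abs]
      exact Real.sqrt_lt_sqrt (sq_nonneg w) (by linarith)
    linarith [neg_abs_le w]
  · intro hx
    refine ⟨x - 1 / x, ?_⟩
    have : (x - 1 / x) ^ 2 + 4 = (x + 1 / x) ^ 2 := by
      field_simp
      ring
    rw [this, Real.sqrt_sq (by positivity)]
    ring

lemma quadratic_add_sqrt_sq_add_four (w : ℝ) :
    ((w + √(w ^ 2 + 4)) / 2) ^ 2 = w * ((w + √(w ^ 2 + 4)) / 2) + 1 := by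
  have := Real.sq_sqrt (show 0 ≤ w ^ 2 + 4 by positivity)
  linarith

lemma injective_add_sqrt_sq_add_four :
    Function.Injective (fun w : ℝ => (w + √(w ^ 2 + 4)) / 2) := by
  intro v w h
  have hpos : 0 < (w + √(w ^ 2 + 4)) / 2 := by
    have := Set.mem_image_of_mem (fun w : ℝ => (w + √(w ^ 2 + 4)) / 2) (Set.mem_univ w)
    rwa [image_add_sqrt_sq_add_four] at this
  have hv := quadratic_add_sqrt_sq_add_four v
  have hw := quadratic_add_sqrt_sq_add_four w
  simp only at h
  rw [h] at hv
  exact mul_right_cancel₀ hpos.ne' (by linarith)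

lemma hasDerivAt_add_sqrt_sq_add_four (w : ℝ) :
    HasDerivAt (fun w : ℝ => (w + √(w ^ 2 + 4)) / 2) ((1 + w / √(w ^ 2 + 4)) / 2) w := by
  have hne : w ^ 2 + 4 ≠ 0 := by positivity
  have h := ((hasDerivAt_id w).add
    ((((hasDerivAt_id w).pow 2).add_const 4).sqrt hne)).div_const 2
  refine h.congr_deriv ?_
  have : √(w ^ 2 + 4) ≠ 0 := (Real.sqrt_pos.2 (by positivity)).ne'
  simp
  field_simp

lemma abs_div_sqrt_sq_add_four_le_one (w : ℝ) : |w / √(w ^ 2 + 4)| ≤ 1 := by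
  have : |w| ≤ √(w ^ 2 + 4) := by
    rw [← Real.sqrt_sq_eq_abs]
    exact Real.sqrt_le_sqrt (by linarith)
  rw [abs_div, abs_of_nonneg (Real.sqrt_nonneg _)]
  exact div_le_one_of_le₀ this (Real.sqrt_nonneg _)

lemma quartic_pos {a : ℝ} (ha : -1 < a) (x : ℝ) : 0 < x ^ 4 + 2 * a * x ^ 2 + 1 := by
  rcases eq_or_ne x 0 with rfl | hx
  · norm_num
  · have : 0 < x ^ 2 := by positivity
    nlinarith [sq_nonneg (x ^ 2 - 1)]

lemma quartic_comp_add_sqrt_sq_add_four {a : ℝ} (ha : -1 < a) (w : ℝ) :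
    ((w + √(w ^ 2 + 4)) / 2) ^ 2 / (((w + √(w ^ 2 + 4)) / 2) ^ 4 +
      2 * a * ((w + √(w ^ 2 + 4)) / 2) ^ 2 + 1) = (w ^ 2 + 2 * (1 + a))⁻¹ := by
  have h := quadratic_add_sqrt_sq_add_four w
  set x := (w + √(w ^ 2 + 4)) / 2
  have hb : 0 < w ^ 2 + 2 * (1 + a) := by nlinarith [sq_nonneg w]
  rw [div_eq_iff (quartic_pos ha x).ne', eq_inv_mul_iff_mul_eq₀ hb.ne']
  have h4 : (x ^ 2 - 1) ^ 2 = (w * x) ^ 2 := by rw [h]; ring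
  linarith

/-- The Cauchy–Schlömilch transformation applied to powers of the quartic kernel. -/
lemma integral_Ioi_quartic_pow {a : ℝ} (ha : -1 < a) (n : ℕ) :
    IntegrableOn (fun x : ℝ => (x ^ 2 / (x ^ 4 + 2 * a * x ^ 2 + 1)) ^ (n + 1)) (Set.Ioi 0) ∧
    ∫ x in Set.Ioi (0 : ℝ), (x ^ 2 / (x ^ 4 + 2 * a * x ^ 2 + 1)) ^ (n + 1) =
      (∫ w : ℝ, (w ^ 2 + 2 * (1 + a))⁻¹ ^ (n + 1)) / 2 := by
  have hb : 0 < 2 * (1 + a) := by linarith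
  set k : ℝ → ℝ := fun w => (w ^ 2 + 2 * (1 + a))⁻¹ ^ (n + 1) with hk
  have ik : Integrable k := integrable_inv_sq_add_pow hb n
  have io : Integrable (fun w : ℝ => (w / √(w ^ 2 + 4)) * k w) := by
    refine ik.bdd_mul (c := 1) ?_ (Filter.Eventually.of_forall fun w => ?_)
    · exact (Continuous.div (by fun_prop) (by fun_prop)
        fun w => (Real.sqrt_pos.2 (by positivity)).ne').aestronglyMeasurable
    · exact abs_div_sqrt_sq_add_four_le_one w
  have ho : ∫ w : ℝ, (w / √(w ^ 2 + 4)) * k w = 0 := by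
    have h := integral_neg_eq_self (fun w : ℝ => (w / √(w ^ 2 + 4)) * k w) volume
    simp only [hk, neg_sq, neg_div, neg_mul, integral_neg] at h
    simp only [hk]
    linarith
  have e : ∀ w : ℝ, |(1 + w / √(w ^ 2 + 4)) / 2| •
      ((fun x : ℝ => (x ^ 2 / (x ^ 4 + 2 * a * x ^ 2 + 1)) ^ (n + 1))
        ((w + √(w ^ 2 + 4)) / 2)) = (k w + (w / √(w ^ 2 + 4)) * k w) / 2 := by
    intro w
    simp only [quartic_comp_add_sqrt_sq_add_four ha, smul_eq_mul, hk]
    rw [abs_of_nonneg (by linarith [neg_le_of_abs_le (abs_div_sqrt_sq_add_four_le_one w)])]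
    ring
  have hd : ∀ w ∈ (Set.univ : Set ℝ), HasDerivWithinAt (fun w : ℝ => (w + √(w ^ 2 + 4)) / 2)
      ((1 + w / √(w ^ 2 + 4)) / 2) Set.univ w :=
    fun w _ => (hasDerivAt_add_sqrt_sq_add_four w).hasDerivWithinAt
  rw [← image_add_sqrt_sq_add_four]
  constructor
  · rw [integrableOn_image_iff_integrableOn_abs_deriv_smul MeasurableSet.univ hd
      injective_add_sqrt_sq_add_four.injOn, integrableOn_univ]
    simp only [e]
    exact (ik.add io).div_const 2
  · rw [integral_image_eq_integral_abs_deriv_smul MeasurableSet.univ hd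
      injective_add_sqrt_sq_add_four.injOn, setIntegral_univ]
    simp only [e]
    rw [integral_div, integral_add ik io, ho, add_zero]

lemma quartic_le {a : ℝ} (ha : -1 < a) (x : ℝ) :
    x ^ 2 / (x ^ 4 + 2 * a * x ^ 2 + 1) ≤ 1 / (2 * (1 + a)) := by
  rw [div_le_div_iff₀ (quartic_pos ha x) (by linarith)]
  nlinarith [sq_nonneg (x ^ 2 - 1)]

theorem integral_analytic_series (a : ℝ) (ha : -1 < a) (c : ℕ → ℝ) (r : ℝ)
    (hr : 1 / (2 * (1 + a)) < r)
    (hsum : Summable (fun n : ℕ => |c n| * r ^ n))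
    (f : ℝ → ℝ)
    (hf : ∀ x : ℝ, |x| ≤ 1 / (2 * (1 + a)) → f x = ∑' n : ℕ, c (n + 1) * x ^ (n + 1)) :
    IntegrableOn (fun x : ℝ => f (x ^ 2 / (x ^ 4 + 2 * a * x ^ 2 + 1))) (Set.Ioi 0) ∧
    Summable (fun n : ℕ =>
      c (n + 1) * (Nat.choose (2 * n) n : ℝ) * (1 / (8 * (1 + a))) ^ n) ∧
    ∫ x in Set.Ioi (0 : ℝ), f (x ^ 2 / (x ^ 4 + 2 * a * x ^ 2 + 1)) =
      Real.pi / (2 ^ ((3 : ℝ) / 2) * Real.sqrt (1 + a)) *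
        ∑' n : ℕ, c (n + 1) * (Nat.choose (2 * n) n : ℝ) * (1 / (8 * (1 + a))) ^ n := by
  have ha' : 0 < 1 + a := by linarith
  have hb : 0 < 2 * (1 + a) := by linarith
  set B : ℝ := 1 / (2 * (1 + a)) with hB
  have hB0 : 0 < B := by positivity
  set g : ℝ → ℝ := fun x => x ^ 2 / (x ^ 4 + 2 * a * x ^ 2 + 1) with hg
  have hg0 : ∀ x, 0 ≤ g x := fun x => div_nonneg (sq_nonneg x) (quartic_pos ha x).le
  have hgB : ∀ x, g x ≤ B := quartic_le ha
  have hgc : Continuous g :=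
    Continuous.div (by fun_prop) (by fun_prop) fun x => (quartic_pos ha x).ne'
  have sB1 : Summable fun n : ℕ => |c (n + 1)| * B ^ (n + 1) := by
    refine (summable_nat_add_iff (f := fun n : ℕ => |c n| * B ^ n) 1).2 ?_
    exact hsum.of_nonneg_of_le (fun n => by positivity) fun n => by gcongr
  have sB : Summable fun n : ℕ => |c (n + 1)| * B ^ n := by
    refine (sB1.div_const B).congr fun n => ?_
    rw [pow_succ, ← mul_assoc, mul_div_cancel_right₀ _ hB0.ne']
  have hle : ∀ n x, ‖c (n + 1) * g x ^ (n + 1)‖ ≤ |c (n + 1)| * B ^ n * g x := by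
    intro n x
    rw [norm_mul, norm_pow, Real.norm_eq_abs, Real.norm_of_nonneg (hg0 x), pow_succ, ← mul_assoc]
    have := hg0 x
    have := hgB x
    gcongr
  have hle' : ∀ n x, ‖c (n + 1) * g x ^ (n + 1)‖ ≤ |c (n + 1)| * B ^ (n + 1) := by
    intro n x
    refine (hle n x).trans ?_
    rw [pow_succ, ← mul_assoc]
    have := hgB x
    gcongr
  have hfg : ∀ x, f (g x) = ∑' n : ℕ, c (n + 1) * g x ^ (n + 1) := fun x =>
    hf _ (by rw [abs_of_nonneg (hg0 x)]; exact hgB x)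
  have ig : IntegrableOn g (Set.Ioi 0) := by simpa using (integral_Ioi_quartic_pow ha 0).1
  have hint : IntegrableOn (fun x => f (g x)) (Set.Ioi 0) := by
    simp only [hfg]
    have hcont : Continuous fun x => ∑' n : ℕ, c (n + 1) * g x ^ (n + 1) :=
      continuous_tsum (fun n => by fun_prop) sB1 hle'
    refine (ig.const_mul (∑' n : ℕ, |c (n + 1)| * B ^ n)).mono' hcont.aestronglyMeasurable
      (Filter.Eventually.of_forall fun x => ?_)
    exact tsum_of_norm_bounded (sB.hasSum.mul_right (g x)) fun n => hle n x
  set K : ℝ := Real.pi / (2 ^ ((3 : ℝ) / 2) * √(1 + a)) with hK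
  have hK0 : 0 < K := by positivity
  have hKeq : Real.pi / √(2 * (1 + a)) / 2 = K := by
    have h32 : (2 : ℝ) ^ ((3 : ℝ) / 2) = 2 * √2 := by
      rw [show (3 : ℝ) / 2 = 1 + 1 / 2 by norm_num, Real.rpow_add two_pos, Real.rpow_one,
        Real.sqrt_eq_rpow]
    rw [hK, h32, Real.sqrt_mul two_pos.le, div_div]
    ring
  have hI : ∀ n : ℕ, ∫ x in Set.Ioi (0 : ℝ), c (n + 1) * g x ^ (n + 1) =
      K * (c (n + 1) * (Nat.choose (2 * n) n : ℝ) * (1 / (8 * (1 + a))) ^ n) := by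
    intro n
    rw [integral_const_mul, (integral_Ioi_quartic_pow ha n).2, integral_inv_sq_add_pow hb,
      ← hKeq, show 4 * (2 * (1 + a)) = 8 * (1 + a) by ring]
    ring
  have hF : ∀ n : ℕ, Integrable (fun x => c (n + 1) * g x ^ (n + 1))
      (volume.restrict (Set.Ioi 0)) := fun n => (integral_Ioi_quartic_pow ha n).1.const_mul _
  have hS : Summable fun n : ℕ => ∫ x in Set.Ioi (0 : ℝ), ‖c (n + 1) * g x ^ (n + 1)‖ := by
    refine (sB.mul_right (∫ x in Set.Ioi (0 : ℝ), g x)).of_nonneg_of_le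
      (fun n => integral_nonneg fun x => norm_nonneg _) fun n => ?_
    rw [← integral_const_mul]
    exact integral_mono (hF n).norm (ig.const_mul _) (hle n)
  have hsumI := hasSum_integral_of_summable_integral_norm hF hS
  simp only [hI, ← hfg] at hsumI
  refine ⟨hint, (summable_mul_left_iff hK0.ne').1 hsumI.summable, ?_⟩
  rw [← hsumI.tsum_eq, tsum_mul_left]
end

section
/- Let a > −1 and b > 0 be real numbers and set c = b/(8(1+a)). Then ∫₀^∞ (1 − exp(−b·x²/(x⁴+2a·x²+1))) dx = (π·b·e^{−2c} / (2^{3/2}·√(1+a))) · [I₀(2c) + I₁(2c)]. -/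
open MeasureTheory

/-- The modified Bessel function of the first kind `I₀`, defined by its
everywhere-convergent power series. -/
noncomputable def besselI0 (z : ℝ) : ℝ :=
  ∑' j : ℕ, (z / 2) ^ (2 * j) / ((Nat.factorial j : ℝ)) ^ 2

/-- The modified Bessel function of the first kind `I₁`, defined by its
everywhere-convergent power series. -/
noncomputable def besselI1 (z : ℝ) : ℝ :=
  ∑' j : ℕ, (z / 2) ^ (2 * j + 1) / ((Nat.factorial j : ℝ) * (Nat.factorial (j + 1) : ℝ))

/-- The Cauchy–Schlömilch transformation for even functions. -/
lemma integral_Ioi_comp_sub_inv_of_even {g : ℝ → ℝ} (hc : Continuous g)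
    (hi : Integrable g) (he : ∀ x, g (-x) = g x) :
    ∫ x in Set.Ioi (0 : ℝ), g (x - x⁻¹) = (1 / 2) * ∫ u, g u := by
  have hd : ∀ x ∈ Set.Ioi (0 : ℝ),
      HasDerivWithinAt (fun x : ℝ => x - x⁻¹) (1 + (x ^ 2)⁻¹) (Set.Ioi 0) x := by
    intro x hx
    have h := (hasDerivAt_id x).sub (hasDerivAt_inv (ne_of_gt hx))
    rw [sub_neg_eq_add] at h
    exact h.hasDerivWithinAt
  have hinj : Set.InjOn (fun x : ℝ => x - x⁻¹) (Set.Ioi 0) := by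
    refine StrictMonoOn.injOn fun x hx y _ hxy => ?_
    have := inv_strictAnti₀ hx hxy
    show x - x⁻¹ < y - y⁻¹
    linarith
  have him : (fun x : ℝ => x - x⁻¹) '' Set.Ioi 0 = Set.univ := by
    refine Set.eq_univ_of_forall fun u => ?_
    have hs : Real.sqrt (u ^ 2 + 4) ^ 2 = u ^ 2 + 4 := Real.sq_sqrt (by positivity)
    have hlt : |u| < Real.sqrt (u ^ 2 + 4) := by
      rw [← Real.sqrt_sq_eq_abs]
      exact Real.sqrt_lt_sqrt (sq_nonneg u) (by linarith)
    have hpos : 0 < (u + Real.sqrt (u ^ 2 + 4)) / 2 := by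
      have := neg_abs_le u
      linarith
    refine ⟨(u + Real.sqrt (u ^ 2 + 4)) / 2, hpos, ?_⟩
    show (u + Real.sqrt (u ^ 2 + 4)) / 2 - ((u + Real.sqrt (u ^ 2 + 4)) / 2)⁻¹ = u
    have hne : u + Real.sqrt (u ^ 2 + 4) ≠ 0 := by linarith
    field_simp
    nlinarith
  have hint : IntegrableOn (fun x : ℝ => |1 + (x ^ 2)⁻¹| • g (x - x⁻¹)) (Set.Ioi 0) := by
    rw [← integrableOn_image_iff_integrableOn_abs_deriv_smul measurableSet_Ioi hd hinj, him]
    exact hi.integrableOn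
  have hmeas : AEStronglyMeasurable (fun x : ℝ => g (x - x⁻¹))
      (volume.restrict (Set.Ioi 0)) :=
    (hc.measurable.comp (measurable_id.sub measurable_inv)).aestronglyMeasurable
  have hint₁ : IntegrableOn (fun x : ℝ => g (x - x⁻¹)) (Set.Ioi 0) := by
    refine Integrable.mono hint hmeas (Filter.Eventually.of_forall fun x => ?_)
    have h : (1 : ℝ) ≤ |1 + (x ^ 2)⁻¹| := by
      rw [abs_of_pos (by positivity)]
      linarith [inv_nonneg.2 (sq_nonneg x)]
    rw [norm_smul, Real.norm_eq_abs |_|, abs_abs]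
    exact le_mul_of_one_le_left (norm_nonneg _) h
  have hint₂ : IntegrableOn (fun x : ℝ => (x ^ 2)⁻¹ * g (x - x⁻¹)) (Set.Ioi 0) := by
    refine (Integrable.sub hint hint₁).congr (Filter.Eventually.of_forall fun x => ?_)
    simp only [Pi.sub_apply, smul_eq_mul]
    rw [abs_of_pos (by positivity)]
    ring
  have hinv : ∫ x in Set.Ioi (0 : ℝ), g (x - x⁻¹) =
      ∫ x in Set.Ioi (0 : ℝ), (x ^ 2)⁻¹ * g (x - x⁻¹) := by
    have him' : (fun x : ℝ => x⁻¹) '' Set.Ioi 0 = Set.Ioi 0 := by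
      ext y
      constructor
      · rintro ⟨x, hx, rfl⟩
        exact Set.mem_Ioi.2 (inv_pos.2 (Set.mem_Ioi.1 hx))
      · exact fun hy => ⟨y⁻¹, Set.mem_Ioi.2 (inv_pos.2 (Set.mem_Ioi.1 hy)), inv_inv y⟩
    have h := integral_image_eq_integral_abs_deriv_smul measurableSet_Ioi
      (fun x hx => (hasDerivAt_inv (ne_of_gt (Set.mem_Ioi.1 hx))).hasDerivWithinAt)
      (inv_injective.injOn (s := Set.Ioi (0 : ℝ))) (fun x : ℝ => g (x - x⁻¹))
    rw [show (Inv.inv : ℝ → ℝ) = fun x => x⁻¹ from rfl, him'] at h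
    rw [h]
    refine setIntegral_congr_fun measurableSet_Ioi fun x _ => ?_
    simp only [smul_eq_mul, abs_neg, inv_inv]
    rw [abs_of_nonneg (by positivity), ← he, neg_sub]
  have hsub := integral_image_eq_integral_abs_deriv_smul measurableSet_Ioi hd hinj g
  rw [him, setIntegral_univ] at hsub
  have hsum : ∫ x in Set.Ioi (0 : ℝ), |1 + (x ^ 2)⁻¹| • g (x - x⁻¹) =
      (∫ x in Set.Ioi (0 : ℝ), g (x - x⁻¹)) +
        ∫ x in Set.Ioi (0 : ℝ), (x ^ 2)⁻¹ * g (x - x⁻¹) := by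
    rw [← integral_add hint₁ hint₂]
    refine setIntegral_congr_fun measurableSet_Ioi fun x _ => ?_
    simp only [smul_eq_mul]
    rw [abs_of_pos (by positivity)]
    ring
  rw [hsub, hsum, ← hinv]
  ring

lemma integral_cos_pow_odd_symm (j : ℕ) :
    ∫ x in (-Real.pi)..Real.pi, Real.cos x ^ (2 * j + 1) = 0 := by
  induction j with
  | zero => simp
  | succ j ih =>
    rw [show 2 * (j + 1) + 1 = (2 * j + 1) + 2 by ring, integral_cos_pow, ih]
    simp

lemma integral_cos_pow_even_symm (j : ℕ) :
    ∫ x in (-Real.pi)..Real.pi, Real.cos x ^ (2 * j) =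
      2 * Real.pi * ((2 * j).factorial / (2 ^ (2 * j) * (j.factorial : ℝ) ^ 2)) := by
  induction j with
  | zero =>
    simp
    ring
  | succ j ih =>
    rw [show 2 * (j + 1) = 2 * j + 2 by ring, integral_cos_pow, ih]
    have : (j.factorial : ℝ) ≠ 0 := by positivity
    simp only [Nat.factorial_succ]
    push_cast
    simp only [Real.sin_pi, Real.sin_neg]
    field_simp
    ring

/-- Termwise integration of the exponential series against a power of the cosine. -/
lemma hasSum_integral_cos_pow_mul_exp (z : ℝ) (k : ℕ) :
    HasSum (fun n : ℕ => (-z) ^ n / n.factorial *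
        ∫ x in (-Real.pi)..Real.pi, Real.cos x ^ (n + k))
      (∫ x in (-Real.pi)..Real.pi, Real.cos x ^ k * Real.exp (-z * Real.cos x)) := by
  have h := intervalIntegral.hasSum_integral_of_dominated_convergence
    (μ := volume) (a := -Real.pi) (b := Real.pi)
    (F := fun (n : ℕ) x => (-z) ^ n / n.factorial * Real.cos x ^ (n + k))
    (f := fun x => Real.cos x ^ k * Real.exp (-z * Real.cos x))
    (fun n _ => |z| ^ n / n.factorial)
    (fun n => Continuous.aestronglyMeasurable (by fun_prop))
    (fun n => Filter.Eventually.of_forall fun x _ => ?_)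
    (Filter.Eventually.of_forall fun x _ => Real.summable_pow_div_factorial _)
    intervalIntegrable_const
    (Filter.Eventually.of_forall fun x _ => ?_)
  · simpa only [intervalIntegral.integral_const_mul] using h
  · rw [norm_mul, norm_div, norm_pow, norm_neg, norm_pow, Real.norm_natCast, Real.norm_eq_abs,
      Real.norm_eq_abs]
    exact mul_le_of_le_one_right (by positivity)
      (pow_le_one₀ (abs_nonneg _) (Real.abs_cos_le_one x))
  · have := (NormedSpace.expSeries_div_hasSum_exp (-z * Real.cos x)).mul_left (Real.cos x ^ k)
    rw [← Real.exp_eq_exp_ℝ] at this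
    refine this.congr_fun fun n => ?_
    rw [mul_pow, pow_add]
    ring

lemma integral_exp_neg_mul_cos (z : ℝ) :
    ∫ x in (-Real.pi)..Real.pi, Real.exp (-z * Real.cos x) = 2 * Real.pi * besselI0 z := by
  have h := hasSum_integral_cos_pow_mul_exp z 0
  rw [← Function.Injective.hasSum_iff (mul_right_injective₀ (two_ne_zero (α := ℕ)))] at h
  · simp only [pow_zero, one_mul] at h
    rw [← h.tsum_eq, besselI0, ← tsum_mul_left]
    refine tsum_congr fun j => ?_
    simp only [Function.comp_apply, add_zero]
    rw [integral_cos_pow_even_symm, (even_two_mul j).neg_pow, div_pow]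
    field_simp
  · intro n hn
    obtain ⟨j, rfl | rfl⟩ := n.even_or_odd'
    · exact absurd ⟨j, rfl⟩ hn
    · rw [add_zero, integral_cos_pow_odd_symm, mul_zero]

lemma integral_cos_mul_exp_neg_mul_cos (z : ℝ) :
    ∫ x in (-Real.pi)..Real.pi, Real.cos x * Real.exp (-z * Real.cos x) =
      -(2 * Real.pi * besselI1 z) := by
  have h := hasSum_integral_cos_pow_mul_exp z 1
  have hinj : Function.Injective (fun j : ℕ => 2 * j + 1) := fun i j hij => by
    simpa using hij
  rw [← hinj.hasSum_iff] at h
  · simp only [pow_one] at h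
    rw [← h.tsum_eq, besselI1, ← tsum_mul_left, ← tsum_neg]
    refine tsum_congr fun j => ?_
    simp only [Function.comp_apply]
    rw [show 2 * j + 1 + 1 = 2 * (j + 1) by ring, integral_cos_pow_even_symm,
      (odd_two_mul_add_one j).neg_pow, div_pow, show 2 * (j + 1) = 2 * j + 1 + 1 by ring]
    simp only [Nat.factorial_succ]
    push_cast
    field_simp
    ring
  · intro n hn
    obtain ⟨j, rfl | rfl⟩ := n.even_or_odd'
    · rw [integral_cos_pow_odd_symm, mul_zero]
    · exact absurd ⟨j, rfl⟩ hn

lemma integral_sin_sq_mul_exp_neg_cos_sq (z : ℝ) :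
    ∫ t in (-(Real.pi / 2))..(Real.pi / 2),
        Real.sin t ^ 2 * Real.exp (-(2 * z) * Real.cos t ^ 2) =
      Real.pi / 2 * Real.exp (-z) * (besselI0 z + besselI1 z) := by
  have h := intervalIntegral.integral_comp_mul_left (a := -(Real.pi / 2)) (b := Real.pi / 2)
    (fun x => Real.exp (-z * Real.cos x) - Real.cos x * Real.exp (-z * Real.cos x))
    (two_ne_zero (α := ℝ))
  rw [show 2 * -(Real.pi / 2) = -Real.pi by ring, show 2 * (Real.pi / 2) = Real.pi by ring,
    intervalIntegral.integral_sub (a := -Real.pi) (b := Real.pi)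
      (Continuous.intervalIntegrable (by fun_prop) _ _)
      (Continuous.intervalIntegrable (by fun_prop) _ _),
    integral_exp_neg_mul_cos, integral_cos_mul_exp_neg_mul_cos] at h
  have hcongr : ∀ t : ℝ, Real.sin t ^ 2 * Real.exp (-(2 * z) * Real.cos t ^ 2) =
      Real.exp (-z) / 2 * (Real.exp (-z * Real.cos (2 * t)) -
        Real.cos (2 * t) * Real.exp (-z * Real.cos (2 * t))) := by
    intro t
    rw [Real.sin_sq, show -(2 * z) * Real.cos t ^ 2 = -z + -z * Real.cos (2 * t) by
      rw [Real.cos_two_mul]; ring, Real.exp_add]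
    rw [show Real.cos t ^ 2 = (Real.cos (2 * t) + 1) / 2 by rw [Real.cos_two_mul]; ring]
    ring
  simp only [hcongr]
  rw [intervalIntegral.integral_const_mul, h, smul_eq_mul]
  ring

/-- Substitution `u = √m tan t` on the real line. -/
lemma integral_eq_integral_sqrt_mul_tan {m : ℝ} (hm : 0 < m) (g : ℝ → ℝ) :
    ∫ u, g u = ∫ t in (-(Real.pi / 2))..(Real.pi / 2),
      Real.sqrt m / Real.cos t ^ 2 * g (Real.sqrt m * Real.tan t) := by
  have hs : 0 < Real.sqrt m := Real.sqrt_pos.2 hm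
  have hd : ∀ t ∈ Set.Ioo (-(Real.pi / 2)) (Real.pi / 2),
      HasDerivWithinAt (fun t => Real.sqrt m * Real.tan t)
        (Real.sqrt m * (1 / Real.cos t ^ 2)) (Set.Ioo (-(Real.pi / 2)) (Real.pi / 2)) t :=
    fun t ht => ((Real.hasDerivAt_tan (Real.cos_pos_of_mem_Ioo ht).ne').const_mul
      _).hasDerivWithinAt
  have hinj : Set.InjOn (fun t => Real.sqrt m * Real.tan t)
      (Set.Ioo (-(Real.pi / 2)) (Real.pi / 2)) :=
    fun x hx y hy hxy => Real.injOn_tan hx hy (mul_left_cancel₀ hs.ne' hxy)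
  have him : (fun t => Real.sqrt m * Real.tan t) '' Set.Ioo (-(Real.pi / 2)) (Real.pi / 2) =
      Set.univ := by
    refine Set.eq_univ_of_forall fun u => ⟨Real.arctan (u / Real.sqrt m),
      Real.arctan_mem_Ioo _, ?_⟩
    simp only [Real.tan_arctan]
    field_simp
  have h := integral_image_eq_integral_abs_deriv_smul measurableSet_Ioo hd hinj g
  rw [him, setIntegral_univ] at h
  rw [h, intervalIntegral.integral_of_le (by linarith [Real.pi_pos]), integral_Ioc_eq_integral_Ioo]
  refine setIntegral_congr_fun measurableSet_Ioo fun t _ => ?_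
  simp only [smul_eq_mul]
  rw [abs_of_nonneg (by positivity), mul_one_div]

lemma one_sub_exp_neg_div_nonneg {b m : ℝ} (hb : 0 < b) (hm : 0 < m) (u : ℝ) :
    0 ≤ 1 - Real.exp (-b / (u ^ 2 + m)) := by
  rw [sub_nonneg, Real.exp_le_one_iff, neg_div, neg_nonpos]
  positivity

lemma one_sub_exp_neg_div_le (b m u : ℝ) :
    1 - Real.exp (-b / (u ^ 2 + m)) ≤ b / (u ^ 2 + m) := by
  have := Real.add_one_le_exp (-b / (u ^ 2 + m))
  rw [neg_div] at this ⊢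
  linarith

lemma integrable_inv_sq_add {m : ℝ} (hm : 0 < m) : Integrable fun u : ℝ => (u ^ 2 + m)⁻¹ := by
  have hs : 0 < Real.sqrt m := Real.sqrt_pos.2 hm
  have h := (integrable_inv_one_add_sq.comp_mul_left' (inv_ne_zero hs.ne')).const_mul m⁻¹
  refine h.congr (Filter.Eventually.of_forall fun u => ?_)
  simp only
  rw [mul_pow, inv_pow, Real.sq_sqrt hm.le, ← mul_inv]
  congr 1
  field_simp
  ring

lemma continuous_one_sub_exp_neg_div {m : ℝ} (b : ℝ) (hm : 0 < m) :
    Continuous fun u : ℝ => 1 - Real.exp (-b / (u ^ 2 + m)) := by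
  have : ∀ u : ℝ, u ^ 2 + m ≠ 0 := fun u => by positivity
  fun_prop (disch := assumption)

lemma integrable_one_sub_exp_neg_div {b m : ℝ} (hb : 0 < b) (hm : 0 < m) :
    Integrable fun u : ℝ => 1 - Real.exp (-b / (u ^ 2 + m)) := by
  refine ((integrable_inv_sq_add hm).const_mul b).mono'
    (continuous_one_sub_exp_neg_div b hm).aestronglyMeasurable
    (Filter.Eventually.of_forall fun u => ?_)
  rw [Real.norm_of_nonneg (one_sub_exp_neg_div_nonneg hb hm u), ← div_eq_mul_inv]
  exact one_sub_exp_neg_div_le b m u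

lemma abs_mul_one_sub_exp_neg_div_le {b m : ℝ} (hb : 0 < b) (hm : 0 < m) (u : ℝ) :
    |u * (1 - Real.exp (-b / (u ^ 2 + m)))| ≤ b * |u|⁻¹ := by
  rcases eq_or_ne u 0 with rfl | hu
  · simp
  have hu' : 0 < |u| := abs_pos.2 hu
  rw [abs_mul, abs_of_nonneg (one_sub_exp_neg_div_nonneg hb hm u)]
  calc |u| * (1 - Real.exp (-b / (u ^ 2 + m))) ≤ |u| * (b / |u| ^ 2) := by
        refine mul_le_mul_of_nonneg_left ((one_sub_exp_neg_div_le b m u).trans ?_) hu'.le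
        rw [sq_abs]
        exact div_le_div_of_nonneg_left hb.le (by positivity) (by linarith)
    _ = b * |u|⁻¹ := by field_simp

/-- Integration by parts against `u`. -/
lemma integral_one_sub_exp_neg_div_eq {b m : ℝ} (hb : 0 < b) (hm : 0 < m) :
    ∫ u : ℝ, (1 - Real.exp (-b / (u ^ 2 + m))) =
      ∫ u : ℝ, 2 * b * u ^ 2 / (u ^ 2 + m) ^ 2 * Real.exp (-b / (u ^ 2 + m)) := by
  have hne : ∀ u : ℝ, u ^ 2 + m ≠ 0 := fun u => by positivity
  have hd : ∀ u : ℝ, HasDerivAt (fun u : ℝ => u * (1 - Real.exp (-b / (u ^ 2 + m))))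
      ((1 - Real.exp (-b / (u ^ 2 + m))) -
        2 * b * u ^ 2 / (u ^ 2 + m) ^ 2 * Real.exp (-b / (u ^ 2 + m))) u := by
    intro u
    have h₁ : HasDerivAt (fun u : ℝ => u ^ 2 + m) (2 * u) u := by
      simpa using (hasDerivAt_pow 2 u).add_const m
    have h₂ := (((hasDerivAt_const u (-b)).div h₁ (hne u)).exp).const_sub 1
    refine ((hasDerivAt_id u).mul h₂).congr_deriv ?_
    simp only [id, Pi.div_apply]
    ring
  have hint : Integrable fun u : ℝ =>
      2 * b * u ^ 2 / (u ^ 2 + m) ^ 2 * Real.exp (-b / (u ^ 2 + m)) := by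
    refine ((integrable_inv_sq_add hm).const_mul (2 * b)).mono' ?_
      (Filter.Eventually.of_forall fun u => ?_)
    · refine Continuous.aestronglyMeasurable ?_
      have hne₂ : ∀ u : ℝ, (u ^ 2 + m) ^ 2 ≠ 0 := fun u => pow_ne_zero 2 (hne u)
      fun_prop (disch := assumption)
    · rw [Real.norm_of_nonneg (by positivity)]
      have hexp : Real.exp (-b / (u ^ 2 + m)) ≤ 1 :=
        sub_nonneg.1 (one_sub_exp_neg_div_nonneg hb hm u)
      refine (mul_le_of_le_one_right (by positivity) hexp).trans ?_
      rw [← div_eq_mul_inv, div_le_div_iff₀ (by positivity) (by positivity)]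
      have : u ^ 2 * (u ^ 2 + m) ≤ (u ^ 2 + m) ^ 2 := by nlinarith [sq_nonneg u]
      nlinarith
  have hlim : ∀ l : Filter ℝ, Filter.Tendsto (fun u : ℝ => |u|) l Filter.atTop →
      Filter.Tendsto (fun u : ℝ => u * (1 - Real.exp (-b / (u ^ 2 + m)))) l (nhds 0) := by
    intro l hl
    refine squeeze_zero_norm (abs_mul_one_sub_exp_neg_div_le hb hm) ?_
    simpa using (tendsto_inv_atTop_zero.comp hl).const_mul b
  have h := integral_of_hasDerivAt_of_tendsto hd
    ((integrable_one_sub_exp_neg_div hb hm).sub hint)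
    (hlim _ Filter.tendsto_abs_atBot_atTop) (hlim _ Filter.tendsto_abs_atTop_atTop)
  rw [integral_sub (integrable_one_sub_exp_neg_div hb hm) hint, sub_zero] at h
  exact sub_eq_zero.1 h

lemma integral_one_sub_exp_neg_div {b m : ℝ} (hb : 0 < b) (hm : 0 < m) :
    ∫ u : ℝ, (1 - Real.exp (-b / (u ^ 2 + m))) =
      Real.pi * b / Real.sqrt m * Real.exp (-(b / (2 * m))) *
        (besselI0 (b / (2 * m)) + besselI1 (b / (2 * m))) := by
  have hs : 0 < Real.sqrt m := Real.sqrt_pos.2 hm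
  rw [integral_one_sub_exp_neg_div_eq hb hm, integral_eq_integral_sqrt_mul_tan hm,
    intervalIntegral.integral_of_le (by linarith [Real.pi_pos]), integral_Ioc_eq_integral_Ioo]
  have hcongr : Set.EqOn (fun t => Real.sqrt m / Real.cos t ^ 2 *
      (2 * b * (Real.sqrt m * Real.tan t) ^ 2 / ((Real.sqrt m * Real.tan t) ^ 2 + m) ^ 2 *
        Real.exp (-b / ((Real.sqrt m * Real.tan t) ^ 2 + m))))
      (fun t => 2 * b / Real.sqrt m *
        (Real.sin t ^ 2 * Real.exp (-(2 * (b / (2 * m))) * Real.cos t ^ 2)))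
      (Set.Ioo (-(Real.pi / 2)) (Real.pi / 2)) := by
    intro t ht
    have hcos := Real.cos_pos_of_mem_Ioo ht
    have hsq : (Real.sqrt m * Real.tan t) ^ 2 = m * (Real.sin t ^ 2 / Real.cos t ^ 2) := by
      rw [mul_pow, Real.sq_sqrt hm.le, Real.tan_eq_sin_div_cos, div_pow]
    have hden : m * (Real.sin t ^ 2 / Real.cos t ^ 2) + m = m / Real.cos t ^ 2 := by
      rw [Real.sin_sq]
      field_simp
      ring
    simp only [hsq, hden]
    rw [show -b / (m / Real.cos t ^ 2) = -(2 * (b / (2 * m))) * Real.cos t ^ 2 by field_simp]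
    have hm' : Real.sqrt m ^ 2 = m := Real.sq_sqrt hm.le
    field_simp
    rw [hm']
  rw [setIntegral_congr_fun measurableSet_Ioo hcongr, ← integral_Ioc_eq_integral_Ioo,
    ← intervalIntegral.integral_of_le (by linarith [Real.pi_pos]),
    intervalIntegral.integral_const_mul, integral_sin_sq_mul_exp_neg_cos_sq]
  ring

theorem integral_one_sub_exp_bessel (a b : ℝ) (ha : -1 < a) (hb : 0 < b)
    (c : ℝ) (hc : c = b / (8 * (1 + a))) :
    ∫ x in Set.Ioi (0 : ℝ),
        (1 - Real.exp (-(b * x ^ 2) / (x ^ 4 + 2 * a * x ^ 2 + 1))) =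
      Real.pi * b * Real.exp (-2 * c) / (2 ^ ((3 : ℝ) / 2) * Real.sqrt (1 + a)) *
        (besselI0 (2 * c) + besselI1 (2 * c)) := by
  have ha' : 0 < 1 + a := by linarith
  have hm : 0 < 2 * (1 + a) := by linarith
  have hcongr : Set.EqOn
      (fun x : ℝ => 1 - Real.exp (-(b * x ^ 2) / (x ^ 4 + 2 * a * x ^ 2 + 1)))
      (fun x => 1 - Real.exp (-b / ((x - x⁻¹) ^ 2 + 2 * (1 + a)))) (Set.Ioi 0) := by
    intro x hx
    have hx0 : x ≠ 0 := ne_of_gt hx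
    have hden : (x - x⁻¹) ^ 2 + 2 * (1 + a) = (x ^ 4 + 2 * a * x ^ 2 + 1) / x ^ 2 := by
      field_simp
      ring
    simp only [hden]
    rw [div_div_eq_mul_div, neg_mul]
  rw [setIntegral_congr_fun measurableSet_Ioi hcongr,
    integral_Ioi_comp_sub_inv_of_even (continuous_one_sub_exp_neg_div b hm)
      (integrable_one_sub_exp_neg_div hb hm) (fun x => by rw [neg_sq]),
    integral_one_sub_exp_neg_div hb hm]
  have h₁ : b / (2 * (2 * (1 + a))) = 2 * c := by
    rw [hc]
    field_simp
    norm_num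
  have h₂ : (2 : ℝ) ^ ((3 : ℝ) / 2) = 2 * Real.sqrt 2 := by
    rw [show (3 : ℝ) / 2 = 1 + 1 / 2 by norm_num, Real.rpow_add two_pos, Real.rpow_one,
      Real.sqrt_eq_rpow]
  rw [h₁, h₂, Real.sqrt_mul two_pos.le, neg_mul]
  field_simp
end

section
/- For every real number x, Σ_{n=0}^∞ (binom(2n, n)/(n+1)!) · x^n = e^{2x} · [I₀(2x) − I₁(2x)], i.e. Σ_{n=0}^∞ (binom(2n, n)/(n+1)!) · x^n = e^{2x} · (Σ_{j=0}^∞ x^{2j}/(j!)² − Σ_{j=0}^∞ x^{2j+1}/(j!·(j+1)!)), all three series converging absolutely. -/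
/-- The power series of `e^{2x}`. -/
noncomputable def expTwoSeries : PowerSeries ℝ :=
  PowerSeries.mk fun n => (2 : ℝ) ^ n / (Nat.factorial n : ℝ)

/-- The coefficients of the power series of `I₀(2x) - I₁(2x)`. -/
noncomputable def besselDiffCoeff (k : ℕ) : ℝ :=
  (-1) ^ k / ((Nat.factorial (k / 2) : ℝ) * (Nat.factorial ((k + 1) / 2) : ℝ))

lemma besselDiffCoeff_even (j : ℕ) :
    besselDiffCoeff (2 * j) = 1 / (Nat.factorial j : ℝ) ^ 2 := by
  have h1 : 2 * j / 2 = j := by omega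
  have h2 : (2 * j + 1) / 2 = j := by omega
  simp [besselDiffCoeff, h1, h2, pow_mul, sq]

lemma besselDiffCoeff_odd (j : ℕ) :
    besselDiffCoeff (2 * j + 1) =
      -(1 / ((Nat.factorial j : ℝ) * (Nat.factorial (j + 1) : ℝ))) := by
  have h1 : (2 * j + 1) / 2 = j := by omega
  have h2 : (2 * j + 1 + 1) / 2 = j + 1 := by omega
  rw [besselDiffCoeff, h1, h2, pow_succ, pow_mul]
  norm_num [neg_div]

lemma besselDiffCoeff_rec (k : ℕ) :
    ((k : ℝ) + 2) * (k + 3) * besselDiffCoeff (k + 2) =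
      4 * besselDiffCoeff k - 2 * besselDiffCoeff (k + 1) := by
  obtain ⟨j, rfl | rfl⟩ := Nat.even_or_odd' k
  · rw [show 2 * j + 2 = 2 * (j + 1) by ring, besselDiffCoeff_even, besselDiffCoeff_even,
      besselDiffCoeff_odd, Nat.factorial_succ]
    have := Nat.factorial_ne_zero j
    push_cast
    field_simp
    ring
  · rw [show 2 * j + 1 + 2 = 2 * (j + 1) + 1 by ring, show 2 * j + 1 + 1 = 2 * (j + 1) by ring,
      besselDiffCoeff_even, besselDiffCoeff_odd, besselDiffCoeff_odd,
      Nat.factorial_succ (j + 1), Nat.factorial_succ j]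
    have := Nat.factorial_ne_zero j
    push_cast
    field_simp
    ring

lemma derivative_expTwoSeries :
    PowerSeries.derivative ℝ expTwoSeries = 2 * expTwoSeries := by
  ext n
  rw [PowerSeries.coeff_derivative, show (2 : PowerSeries ℝ) = PowerSeries.C (2 : ℝ) from
    (map_ofNat PowerSeries.C 2).symm, PowerSeries.coeff_C_mul]
  simp only [expTwoSeries, PowerSeries.coeff_mk, Nat.factorial_succ]
  have := Nat.factorial_ne_zero n
  push_cast
  field_simp
  ring

lemma besselDiffSeries_ode :
    let B := PowerSeries.mk besselDiffCoeff
    PowerSeries.X * PowerSeries.derivative ℝ (PowerSeries.derivative ℝ B)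
      + 2 * PowerSeries.derivative ℝ B + 2 * B - 4 * (PowerSeries.X * B) = 0 := by
  intro B
  ext n
  rw [show (2 : PowerSeries ℝ) = PowerSeries.C (2 : ℝ) from (map_ofNat PowerSeries.C 2).symm,
    show (4 : PowerSeries ℝ) = PowerSeries.C (4 : ℝ) from (map_ofNat PowerSeries.C 4).symm]
  rcases n with _ | n
  · simp only [map_sub, map_add, PowerSeries.coeff_C_mul, PowerSeries.coeff_zero_X_mul,
      PowerSeries.coeff_derivative, B, PowerSeries.coeff_mk]
    norm_num [besselDiffCoeff]
  · simp only [map_sub, map_add, PowerSeries.coeff_C_mul, PowerSeries.coeff_succ_X_mul,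
      PowerSeries.coeff_derivative, B, PowerSeries.coeff_mk, map_zero]
    have := besselDiffCoeff_rec n
    push_cast
    linear_combination this

lemma expTwoSeries_mul_ode :
    let P := expTwoSeries * PowerSeries.mk besselDiffCoeff
    PowerSeries.X * PowerSeries.derivative ℝ (PowerSeries.derivative ℝ P)
      + 2 * PowerSeries.derivative ℝ P =
      4 * (PowerSeries.X * PowerSeries.derivative ℝ P) + 2 * P := by
  intro P
  have hB := besselDiffSeries_ode
  have h2 : PowerSeries.derivative ℝ (2 : PowerSeries ℝ) = 0 := by
    rw [show (2 : PowerSeries ℝ) = PowerSeries.C (2 : ℝ) from (map_ofNat PowerSeries.C 2).symm]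
    exact PowerSeries.derivative_C
  simp only [P, Derivation.leibniz, map_add, derivative_expTwoSeries, smul_eq_mul, h2] at hB ⊢
  linear_combination expTwoSeries * hB

lemma coeff_expTwoSeries_mul (n : ℕ) :
    PowerSeries.coeff n (expTwoSeries * PowerSeries.mk besselDiffCoeff) =
      (Nat.choose (2 * n) n : ℝ) / (Nat.factorial (n + 1) : ℝ) := by
  have hode := expTwoSeries_mul_ode
  induction n with
  | zero => simp [expTwoSeries, besselDiffCoeff]
  | succ n ih =>
    have h := congrArg (PowerSeries.coeff n) hode
    have hrec : ((n : ℝ) + 1) * (n + 2) *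
        PowerSeries.coeff (n + 1) (expTwoSeries * PowerSeries.mk besselDiffCoeff) =
        (4 * n + 2) * PowerSeries.coeff n (expTwoSeries * PowerSeries.mk besselDiffCoeff) := by
      rw [show (2 : PowerSeries ℝ) = PowerSeries.C (2 : ℝ) from (map_ofNat PowerSeries.C 2).symm,
        show (4 : PowerSeries ℝ) = PowerSeries.C (4 : ℝ) from
          (map_ofNat PowerSeries.C 4).symm] at h
      rcases n with _ | n
      · simp only [map_add, PowerSeries.coeff_C_mul, PowerSeries.coeff_zero_X_mul,
          PowerSeries.coeff_derivative] at h
        push_cast at h ⊢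
        linear_combination h
      · simp only [map_add, PowerSeries.coeff_C_mul, PowerSeries.coeff_succ_X_mul,
          PowerSeries.coeff_derivative] at h
        push_cast at h ⊢
        linear_combination h
    rw [ih] at hrec
    have hc : ((n : ℝ) + 1) * (Nat.choose (2 * (n + 1)) (n + 1) : ℝ) =
        2 * (2 * n + 1) * (Nat.choose (2 * n) n : ℝ) := by
      exact_mod_cast Nat.succ_mul_centralBinom_succ n
    have hn : ((n : ℝ) + 1) * (n + 2) ≠ 0 := by positivity
    apply mul_left_cancel₀ hn
    rw [hrec, Nat.factorial_succ (n + 1)]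
    have := Nat.factorial_ne_zero (n + 1)
    push_cast
    field_simp
    linear_combination -(n + 2 : ℝ) * hc

lemma summable_catalan_series (x : ℝ) :
    Summable (fun n : ℕ =>
      |((Nat.choose (2 * n) n : ℝ) / (Nat.factorial (n + 1) : ℝ)) * x ^ n|) := by
  refine Summable.of_nonneg_of_le (fun _ => abs_nonneg _) (fun n => ?_)
    (Real.summable_pow_div_factorial (4 * |x|))
  rw [abs_mul, abs_pow, mul_pow, mul_div_right_comm, abs_of_nonneg (by positivity)]
  have h : (Nat.choose (2 * n) n : ℝ) ≤ 4 ^ n := by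
    have := Nat.choose_le_two_pow (2 * n) n
    rw [pow_mul] at this
    exact_mod_cast this
  gcongr
  exact Nat.le_succ n

lemma summable_bessel_zero (x : ℝ) :
    Summable (fun j : ℕ => |x ^ (2 * j) / ((Nat.factorial j : ℝ)) ^ 2|) := by
  refine Summable.of_nonneg_of_le (fun _ => abs_nonneg _) (fun j => ?_)
    (Real.summable_pow_div_factorial (x ^ 2))
  rw [pow_mul, abs_of_nonneg (by positivity)]
  have : (1 : ℝ) ≤ Nat.factorial j := by exact_mod_cast Nat.factorial_pos j
  gcongr
  nlinarith

lemma summable_bessel_one (x : ℝ) :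
    Summable (fun j : ℕ =>
      |x ^ (2 * j + 1) / ((Nat.factorial j : ℝ) * (Nat.factorial (j + 1) : ℝ))|) := by
  refine Summable.of_nonneg_of_le (fun _ => abs_nonneg _) (fun j => ?_)
    ((Real.summable_pow_div_factorial (x ^ 2)).mul_right |x|)
  rw [pow_succ, pow_mul, abs_div, abs_mul, abs_of_nonneg (a := (x ^ 2) ^ j) (by positivity),
    abs_of_nonneg (a := (Nat.factorial j : ℝ) * _) (by positivity), div_mul_eq_mul_div]
  have : (1 : ℝ) ≤ Nat.factorial (j + 1) := by exact_mod_cast Nat.factorial_pos (j + 1)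
  gcongr
  exact le_mul_of_one_le_right (by positivity) this

lemma hasSum_besselDiffCoeff (x : ℝ) :
    HasSum (fun k : ℕ => besselDiffCoeff k * x ^ k)
      ((∑' j : ℕ, x ^ (2 * j) / ((Nat.factorial j : ℝ)) ^ 2) -
        ∑' j : ℕ, x ^ (2 * j + 1) / ((Nat.factorial j : ℝ) * (Nat.factorial (j + 1) : ℝ))) := by
  rw [sub_eq_add_neg]
  refine HasSum.even_add_odd ?_ ?_
  · refine (summable_bessel_zero x).of_abs.hasSum.congr_fun fun j => ?_
    rw [besselDiffCoeff_even]
    ring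
  · refine (summable_bessel_one x).of_abs.hasSum.neg.congr_fun fun j => ?_
    rw [besselDiffCoeff_odd]
    ring

theorem catalan_series_eq_exp_mul_bessel (x : ℝ) :
    Summable (fun n : ℕ =>
      |((Nat.choose (2 * n) n : ℝ) / (Nat.factorial (n + 1) : ℝ)) * x ^ n|) ∧
    Summable (fun j : ℕ => |x ^ (2 * j) / ((Nat.factorial j : ℝ)) ^ 2|) ∧
    Summable (fun j : ℕ =>
      |x ^ (2 * j + 1) / ((Nat.factorial j : ℝ) * (Nat.factorial (j + 1) : ℝ))|) ∧
    ∑' n : ℕ, ((Nat.choose (2 * n) n : ℝ) / (Nat.factorial (n + 1) : ℝ)) * x ^ n =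
      Real.exp (2 * x) *
        ((∑' j : ℕ, x ^ (2 * j) / ((Nat.factorial j : ℝ)) ^ 2) -
          ∑' j : ℕ, x ^ (2 * j + 1) / ((Nat.factorial j : ℝ) * (Nat.factorial (j + 1) : ℝ))) := by
  refine ⟨summable_catalan_series x, summable_bessel_zero x, summable_bessel_one x, ?_⟩
  have hexp : Real.exp (2 * x) = ∑' n : ℕ, (2 * x) ^ n / (Nat.factorial n : ℝ) := by
    rw [Real.exp_eq_exp_ℝ, NormedSpace.exp_eq_tsum_div]
  rw [← (hasSum_besselDiffCoeff x).tsum_eq, hexp,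
    tsum_mul_tsum_eq_tsum_sum_antidiagonal_of_summable_norm
      (Real.summable_pow_div_factorial (2 * x)).norm (hasSum_besselDiffCoeff x).summable.norm]
  refine tsum_congr fun n => ?_
  rw [← coeff_expTwoSeries_mul, PowerSeries.coeff_mul, Finset.sum_mul]
  refine Finset.sum_congr rfl fun p hp => ?_
  rw [← Finset.HasAntidiagonal.mem_antidiagonal.mp hp, expTwoSeries, PowerSeries.coeff_mk, PowerSeries.coeff_mk]
  ring
end

section
/- For every real number c, Σ_{k=0}^∞ ((−1)^k / (2k+1)!) · binom(4k, 2k) · c^{2k} = J₀(2c)·cos(2c) + J₁(2c)·sin(2c), all series converging absolutely. -/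
/-- The Bessel function of the first kind `J₀`, defined by its
everywhere-convergent power series. -/
noncomputable def besselJ0 (z : ℝ) : ℝ :=
  ∑' k : ℕ, (-1 : ℝ) ^ k * (z / 2) ^ (2 * k) / ((Nat.factorial k : ℝ)) ^ 2

/-- The Bessel function of the first kind `J₁`, defined by its
everywhere-convergent power series. -/
noncomputable def besselJ1 (z : ℝ) : ℝ :=
  ∑' k : ℕ, (-1 : ℝ) ^ k * (z / 2) ^ (2 * k + 1) /
    ((Nat.factorial k : ℝ) * (Nat.factorial (k + 1) : ℝ))

open Polynomial in
lemma coeff_one_add_X_mul_one_add_X_sq_pow (m : ℕ) :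
    ((1 + X) * (1 + X ^ 2) ^ m : ℤ[X]).coeff m = m.choose (m / 2) := by
  have h : ((1 + X ^ 2) ^ m : ℤ[X]) = expand ℤ 2 ((1 + X) ^ m) := by simp
  rw [h, add_mul, one_mul, coeff_add, coeff_expand two_pos, coeff_one_add_X_pow]
  rcases m with _ | m
  · simp
  · rw [coeff_X_mul, coeff_expand two_pos, coeff_one_add_X_pow]
    rcases Nat.even_or_odd' m with ⟨k, rfl | rfl⟩
    · have h1 : ¬ 2 ∣ 2 * k + 1 := by omega
      have h2 : (2 * k + 1) / 2 = 2 * k / 2 := by omega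
      simp [h1, h2]
    · have h1 : ¬ 2 ∣ 2 * k + 1 := by omega
      have h2 : 2 ∣ 2 * k + 1 + 1 := by omega
      simp [h1, h2]

open Polynomial in
lemma sum_choose_mul_choose_half (n : ℕ) :
    ((n : ℤ) + 1) * ∑ m ∈ Finset.range (n + 1),
      (-1) ^ m * 2 ^ (n - m) * (n.choose m : ℤ) * (m.choose (m / 2) : ℤ) =
      ((2 * n).choose n : ℤ) := by
  have hexp : (1 + X) * ((-1) ^ n * (X - 1) ^ (2 * n)) =
      ∑ m ∈ Finset.range (n + 1), C ((-1) ^ m * 2 ^ (n - m) * (n.choose m : ℤ)) *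
        (((1 + X) * (1 + X ^ 2) ^ m) * X ^ (n - m)) := by
    have h : ((-1) ^ n * (X - 1) ^ (2 * n) : ℤ[X]) = (-(1 + X ^ 2) + 2 * X) ^ n := by
      rw [pow_mul, ← mul_pow]
      congr 1
      ring
    rw [h, add_pow, Finset.mul_sum]
    refine Finset.sum_congr rfl fun m _ => ?_
    rw [neg_pow (1 + X ^ 2 : ℤ[X]), mul_pow]
    simp only [map_mul, map_pow, map_neg, map_one, map_natCast, map_ofNat]
    ring
  have hcoeff := congrArg (fun p => coeff p n) hexp
  simp only [finsetSum_coeff, coeff_C_mul] at hcoeff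
  have hsum : ∑ m ∈ Finset.range (n + 1), (-1) ^ m * 2 ^ (n - m) * (n.choose m : ℤ) *
      (((1 + X) * (1 + X ^ 2) ^ m) * X ^ (n - m) : ℤ[X]).coeff n =
      ∑ m ∈ Finset.range (n + 1),
        (-1) ^ m * 2 ^ (n - m) * (n.choose m : ℤ) * (m.choose (m / 2) : ℤ) := by
    refine Finset.sum_congr rfl fun m hm => ?_
    have hmn : m ≤ n := by simpa [Nat.lt_succ_iff] using hm
    rw [coeff_mul_X_pow', if_pos (Nat.sub_le _ _), Nat.sub_sub_self hmn,
      coeff_one_add_X_mul_one_add_X_sq_pow]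
  rw [← hsum, ← hcoeff]
  have hc (k : ℕ) (hk : k ≤ 2 * n) : ((-1) ^ n * (X - 1) ^ (2 * n) : ℤ[X]).coeff k =
      (-1) ^ (n + k) * ((2 * n).choose k : ℤ) := by
    have h1 : ((-1) ^ n * (X - 1) ^ (2 * n) : ℤ[X]) =
        C ((-1) ^ n) * (X + C (-1)) ^ (2 * n) := by
      simp [sub_eq_add_neg]
    have h2 : (-1 : ℤ) ^ (2 * n - k) = (-1) ^ k := by
      have h3 : Even (2 * n - k) ↔ Even k := by simp [Nat.even_sub hk]
      exact neg_one_pow_congr h3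
    rw [h1, coeff_C_mul, coeff_X_add_C_pow, h2, pow_add]
    ring
  rw [add_mul (1 : ℤ[X]), one_mul, coeff_add, hc n (by omega)]
  rcases n with _ | k
  · simp
  · rw [coeff_X_mul, hc k (by omega)]
    have h := Nat.choose_succ_right_eq (2 * (k + 1)) k
    have h' : 2 * (k + 1) - k = k + 2 := by omega
    rw [h'] at h
    zify at h
    have e1 : (-1 : ℤ) ^ (k + 1 + (k + 1)) = 1 := Even.neg_one_pow ⟨k + 1, rfl⟩
    have e2 : (-1 : ℤ) ^ (k + 1 + k) = -1 := Odd.neg_one_pow ⟨k, by ring⟩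
    rw [e1, e2]
    push_cast
    linear_combination h

/-- The terms of the power series of `I₀ (2 * z) + I₁ (2 * z)`; the even terms belong to
the modified Bessel function `I₀`, the odd terms to `I₁`. -/
noncomputable def besselTerm (z : ℂ) (m : ℕ) : ℂ :=
  z ^ m / (((m / 2).factorial : ℂ) * (((m + 1) / 2).factorial : ℂ))

lemma besselTerm_eq_choose (z : ℂ) (m : ℕ) :
    besselTerm z m = (m.choose (m / 2) : ℂ) * (z ^ m / (m.factorial : ℂ)) := by
  have h : m - m / 2 = (m + 1) / 2 := by omega
  have h1 := Nat.choose_mul_factorial_mul_factorial (Nat.div_le_self m 2)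
  rw [h] at h1
  have h2 : (m.choose (m / 2) : ℂ) * ((m / 2).factorial : ℂ) * (((m + 1) / 2).factorial : ℂ) =
    (m.factorial : ℂ) := mod_cast h1
  have n1 : ((m / 2).factorial : ℂ) ≠ 0 := mod_cast Nat.factorial_ne_zero _
  have n2 : (((m + 1) / 2).factorial : ℂ) ≠ 0 := mod_cast Nat.factorial_ne_zero _
  have n3 : (m.factorial : ℂ) ≠ 0 := mod_cast Nat.factorial_ne_zero _
  rw [besselTerm]
  field_simp
  linear_combination -(z ^ m) * h2

lemma summable_norm_besselTerm (z : ℂ) : Summable fun m => ‖besselTerm z m‖ := by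
  refine (Real.summable_pow_div_factorial (2 * ‖z‖)).of_nonneg_of_le
    (fun _ => norm_nonneg _) fun m => ?_
  rw [besselTerm_eq_choose, norm_mul, norm_div, norm_pow, Complex.norm_natCast,
    Complex.norm_natCast, mul_pow, mul_div_assoc]
  gcongr
  exact_mod_cast Nat.choose_le_two_pow m (m / 2)

lemma summable_norm_choose_div_factorial_succ (z : ℂ) :
    Summable fun n : ℕ => ‖((2 * n).choose n : ℂ) * z ^ n / ((n + 1).factorial : ℂ)‖ := by
  refine (Real.summable_pow_div_factorial (4 * ‖z‖)).of_nonneg_of_le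
    (fun _ => norm_nonneg _) fun n => ?_
  rw [norm_div, norm_mul, norm_pow, Complex.norm_natCast, Complex.norm_natCast, mul_pow]
  have h : ((2 * n).choose n : ℝ) ≤ 4 ^ n := by
    have := Nat.choose_le_two_pow (2 * n) n
    rw [pow_mul] at this
    exact_mod_cast this
  gcongr
  exact Nat.le_succ n

lemma exp_mul_tsum_besselTerm (t : ℂ) :
    Complex.exp (2 * t) * ∑' m, besselTerm (-t) m =
      ∑' n : ℕ, ((2 * n).choose n : ℂ) * t ^ n / ((n + 1).factorial : ℂ) := by
  have hexp : Complex.exp (2 * t) = ∑' n : ℕ, (2 * t) ^ n / (n.factorial : ℂ) := by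
    rw [Complex.exp_eq_exp_ℂ, NormedSpace.exp_eq_tsum_div]
  rw [hexp, mul_comm, tsum_mul_tsum_eq_tsum_sum_range_of_summable_norm
    (summable_norm_besselTerm _) (NormedSpace.norm_expSeries_div_summable (2 * t))]
  refine tsum_congr fun n => ?_
  have h : ((n : ℂ) + 1) * ∑ m ∈ Finset.range (n + 1),
      (-1) ^ m * 2 ^ (n - m) * (n.choose m : ℂ) * (m.choose (m / 2) : ℂ) =
      ((2 * n).choose n : ℂ) := mod_cast sum_choose_mul_choose_half n
  have n1 : (n : ℂ) + 1 ≠ 0 := mod_cast Nat.succ_ne_zero n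
  have n2 : (n.factorial : ℂ) ≠ 0 := mod_cast Nat.factorial_ne_zero _
  rw [← h, Nat.factorial_succ, Nat.cast_mul, Nat.cast_succ, mul_assoc,
    mul_div_mul_left _ _ n1, Finset.sum_mul, Finset.sum_div]
  refine Finset.sum_congr rfl fun m hm => ?_
  have hmn : m ≤ n := by simpa [Nat.lt_succ_iff] using hm
  have n3 : (m.factorial : ℂ) ≠ 0 := mod_cast Nat.factorial_ne_zero _
  have n4 : ((n - m).factorial : ℂ) ≠ 0 := mod_cast Nat.factorial_ne_zero _
  rw [besselTerm_eq_choose, Nat.cast_choose ℂ hmn, neg_pow, mul_pow]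
  have ht : t ^ n = t ^ m * t ^ (n - m) := by rw [← pow_add, Nat.add_sub_cancel' hmn]
  rw [ht]
  field_simp

lemma besselTerm_neg_I_mul_even (c : ℝ) (k : ℕ) :
    besselTerm (-(Complex.I * c)) (2 * k) =
      (((-1 : ℝ) ^ k * (2 * c / 2) ^ (2 * k) / (k.factorial : ℝ) ^ 2 : ℝ) : ℂ) := by
  have h1 : 2 * k / 2 = k := by omega
  have h2 : (2 * k + 1) / 2 = k := by omega
  have h3 : (-(Complex.I * c)) ^ 2 = -(c : ℂ) ^ 2 := by
    rw [neg_sq, mul_pow, Complex.I_sq]; ring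
  rw [besselTerm, h1, h2, pow_mul, h3, neg_pow, mul_div_cancel_left₀ c two_ne_zero]
  push_cast
  ring

lemma besselTerm_neg_I_mul_odd (c : ℝ) (k : ℕ) :
    besselTerm (-(Complex.I * c)) (2 * k + 1) =
      -Complex.I * (((-1 : ℝ) ^ k * (2 * c / 2) ^ (2 * k + 1) /
        ((k.factorial : ℝ) * ((k + 1).factorial : ℝ)) : ℝ) : ℂ) := by
  have h1 : (2 * k + 1) / 2 = k := by omega
  have h2 : (2 * k + 1 + 1) / 2 = k + 1 := by omega
  have h3 : (-(Complex.I * c)) ^ 2 = -(c : ℂ) ^ 2 := by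
    rw [neg_sq, mul_pow, Complex.I_sq]; ring
  rw [besselTerm, h1, h2, pow_succ, pow_mul, h3, neg_pow, mul_div_cancel_left₀ c two_ne_zero]
  push_cast
  ring

lemma tsum_besselTerm_neg_I_mul (c : ℝ) :
    ∑' m, besselTerm (-(Complex.I * c)) m =
      (besselJ0 (2 * c) : ℂ) - Complex.I * (besselJ1 (2 * c) : ℂ) := by
  have hs := (summable_norm_besselTerm (-(Complex.I * c))).of_norm
  rw [← tsum_even_add_odd
    (hs.comp_injective (mul_right_injective₀ (two_ne_zero (α := ℕ))))
    (hs.comp_injective ((add_left_injective 1).comp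
      (mul_right_injective₀ (two_ne_zero (α := ℕ)))))]
  simp only [besselTerm_neg_I_mul_even, besselTerm_neg_I_mul_odd, tsum_mul_left,
    ← Complex.ofReal_tsum]
  rw [besselJ0, besselJ1]
  ring

lemma choose_mul_I_mul_pow_even (c : ℝ) (k : ℕ) :
    ((2 * (2 * k)).choose (2 * k) : ℂ) * (Complex.I * c) ^ (2 * k) /
      ((2 * k + 1).factorial : ℂ) =
      ((((-1 : ℝ) ^ k / ((2 * k + 1).factorial : ℝ)) * ((4 * k).choose (2 * k) : ℝ) *
        c ^ (2 * k) : ℝ) : ℂ) := by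
  have h : 2 * (2 * k) = 4 * k := by ring
  rw [h, mul_pow, pow_mul Complex.I, Complex.I_sq]
  push_cast
  ring

lemma choose_mul_I_mul_pow_odd_re (c : ℝ) (k : ℕ) :
    (((2 * (2 * k + 1)).choose (2 * k + 1) : ℂ) * (Complex.I * c) ^ (2 * k + 1) /
      ((2 * k + 1 + 1).factorial : ℂ)).re = 0 := by
  have h : ((2 * (2 * k + 1)).choose (2 * k + 1) : ℂ) * (Complex.I * c) ^ (2 * k + 1) /
      ((2 * k + 1 + 1).factorial : ℂ) =
      ((((2 * (2 * k + 1)).choose (2 * k + 1) : ℝ) * ((-1) ^ k * c ^ (2 * k + 1)) /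
        ((2 * k + 1 + 1).factorial : ℝ) : ℝ) : ℂ) * Complex.I := by
    rw [mul_pow, pow_succ Complex.I, pow_mul Complex.I, Complex.I_sq]
    push_cast
    ring
  rw [h, Complex.re_ofReal_mul, Complex.I_re, mul_zero]

theorem series_eq_besselJ_combination (c : ℝ) :
    Summable (fun k : ℕ =>
      |((-1 : ℝ) ^ k / (Nat.factorial (2 * k + 1) : ℝ)) *
        (Nat.choose (4 * k) (2 * k) : ℝ) * c ^ (2 * k)|) ∧
    Summable (fun k : ℕ =>
      |(-1 : ℝ) ^ k * (2 * c / 2) ^ (2 * k) / ((Nat.factorial k : ℝ)) ^ 2|) ∧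
    Summable (fun k : ℕ =>
      |(-1 : ℝ) ^ k * (2 * c / 2) ^ (2 * k + 1) /
        ((Nat.factorial k : ℝ) * (Nat.factorial (k + 1) : ℝ))|) ∧
    ∑' k : ℕ, ((-1 : ℝ) ^ k / (Nat.factorial (2 * k + 1) : ℝ)) *
        (Nat.choose (4 * k) (2 * k) : ℝ) * c ^ (2 * k) =
      besselJ0 (2 * c) * Real.cos (2 * c) + besselJ1 (2 * c) * Real.sin (2 * c) := by
  have hinj : Function.Injective fun k : ℕ => 2 * k :=
    mul_right_injective₀ two_ne_zero
  have hinj' : Function.Injective fun k : ℕ => 2 * k + 1 :=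
    (add_left_injective 1).comp hinj
  have hb := summable_norm_besselTerm (-(Complex.I * c))
  have ha := summable_norm_choose_div_factorial_succ (Complex.I * c)
  refine ⟨(ha.comp_injective hinj).congr fun k => ?_, (hb.comp_injective hinj).congr fun k => ?_,
    (hb.comp_injective hinj').congr fun k => ?_, ?_⟩
  · rw [Function.comp_apply, choose_mul_I_mul_pow_even, Complex.norm_real, Real.norm_eq_abs]
  · rw [Function.comp_apply, besselTerm_neg_I_mul_even, Complex.norm_real, Real.norm_eq_abs]
  · rw [Function.comp_apply, besselTerm_neg_I_mul_odd, norm_mul, norm_neg, Complex.norm_I,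
      one_mul, Complex.norm_real, Real.norm_eq_abs]
  · have h := exp_mul_tsum_besselTerm (Complex.I * c)
    let f : ℕ → ℂ := fun n =>
      ((2 * n).choose n : ℂ) * (Complex.I * c) ^ n / ((n + 1).factorial : ℂ)
    have hs : Summable f := ha.of_norm
    have hs_odd : Summable fun k => f (2 * k + 1) := hs.comp_injective hinj'
    have hsplit := tsum_even_add_odd (f := f) (hs.comp_injective hinj) hs_odd
    rw [tsum_besselTerm_neg_I_mul] at h
    replace h := h.trans hsplit.symm
    have hre := congrArg Complex.re h
    rw [Complex.add_re, Complex.re_tsum hs_odd,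
      tsum_congr (choose_mul_I_mul_pow_odd_re c), tsum_zero, add_zero,
      tsum_congr (choose_mul_I_mul_pow_even c), ← Complex.ofReal_tsum, Complex.ofReal_re] at hre
    rw [← hre]
    have he : Complex.exp (2 * (Complex.I * c)) =
        (Real.cos (2 * c) : ℂ) + (Real.sin (2 * c) : ℂ) * Complex.I := by
      rw [Complex.ofReal_cos, Complex.ofReal_sin, ← Complex.exp_mul_I]
      congr 1
      push_cast
      ring
    rw [he]
    simp only [Complex.mul_re, Complex.mul_im, Complex.add_re, Complex.add_im, Complex.sub_re,
      Complex.sub_im, Complex.ofReal_re, Complex.ofReal_im, Complex.I_re, Complex.I_im]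
    ring
end

section
/- Let a > −1 and b > 0 be real numbers and set c = b/(8(1+a)). Then ∫₀^∞ Si(b·x²/(x⁴+2a·x²+1)) dx = π·√(2(1+a)) · [(4c·cos(2c) − sin(2c))·J₀(2c) + 4c·sin(2c)·J₁(2c)], where Si(x) = ∫₀^x (sin t)/t dt is the sine integral. -/
open MeasureTheory

/-- The sine integral `Si(x) = ∫₀ˣ (sin t)/t dt`. -/
noncomputable def sineIntegral (x : ℝ) : ℝ :=
  ∫ t in (0 : ℝ)..x, Real.sin t / t

open Set Filter Topology

/-- Transfer of a derivative along a pointwise equality of functions. -/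
theorem hasDerivAt_of_forall_eq {f g : ℝ → ℝ} {f' g' x : ℝ} (h : HasDerivAt g g' x)
    (hfg : ∀ y, f y = g y) (hd : f' = g') : HasDerivAt f f' x := by
  rwa [funext hfg, hd]

/-- Two functions with the same derivative everywhere that agree at `0` are equal. -/
theorem eq_of_hasDerivAt_eq {f g f' : ℝ → ℝ} (hf : ∀ x, HasDerivAt f (f' x) x)
    (hg : ∀ x, HasDerivAt g (f' x) x) (h0 : f 0 = g 0) (x : ℝ) : f x = g x := by
  have h := is_const_of_deriv_eq_zero (f := fun x => f x - g x)
    (fun x => ((hf x).sub (hg x)).differentiableAt)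
    (fun x => by simpa using ((hf x).fun_sub (hg x)).deriv) x 0
  simp only [h0, sub_self] at h
  linarith

/-! ### Integral representations of the Bessel functions -/

theorem integral_cos_pow_even (k : ℕ) :
    ∫ φ in (0 : ℝ)..Real.pi, Real.cos φ ^ (2 * k) =
      Real.pi * ((2 * k).factorial / (4 ^ k * (k.factorial : ℝ) ^ 2)) := by
  induction k with
  | zero => simp
  | succ k ih =>
    rw [show 2 * (k + 1) = 2 * k + 2 by ring, integral_cos_pow, ih]
    have : (k.factorial : ℝ) ≠ 0 := by positivity
    simp only [Real.sin_pi, Real.sin_zero, Nat.factorial_succ]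
    push_cast
    field_simp
    ring

/-- Termwise integration of a uniformly absolutely convergent series over `[0, π]`. -/
theorem hasSum_integral_zero_pi {F : ℕ → ℝ → ℝ} {f : ℝ → ℝ} {u : ℕ → ℝ}
    (hF : ∀ n, Continuous (F n)) (hu : Summable u) (hFu : ∀ n φ, |F n φ| ≤ u n)
    (hf : ∀ φ, HasSum (fun n => F n φ) (f φ)) :
    HasSum (fun n => ∫ φ in (0 : ℝ)..Real.pi, F n φ) (∫ φ in (0 : ℝ)..Real.pi, f φ) := by
  refine intervalIntegral.hasSum_integral_of_dominated_convergence (fun n _ => u n)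
    (fun n => (hF n).aestronglyMeasurable) ?_ ?_ ?_ ?_
  · exact fun n => ae_of_all _ fun φ _ => hFu n φ
  · exact ae_of_all _ fun φ _ => hu
  · exact intervalIntegrable_const
  · exact ae_of_all _ fun φ _ => hf φ

theorem integral_cos_mul_cos (z : ℝ) :
    ∫ φ in (0 : ℝ)..Real.pi, Real.cos (z * Real.cos φ) = Real.pi * besselJ0 z := by
  have h := hasSum_integral_zero_pi
    (F := fun n φ => (-1) ^ n * (z * Real.cos φ) ^ (2 * n) / (2 * n).factorial)
    (u := fun n => |(-1) ^ n * z ^ (2 * n) / (2 * n).factorial|)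
    (fun n => by fun_prop) (Real.hasSum_cos z).summable.abs
    (fun n φ => by
      rw [show (-1) ^ n * (z * Real.cos φ) ^ (2 * n) / ((2 * n).factorial : ℝ) =
        (-1) ^ n * z ^ (2 * n) / (2 * n).factorial * Real.cos φ ^ (2 * n) by ring, abs_mul]
      refine mul_le_of_le_one_right (abs_nonneg _) ?_
      rw [abs_pow]
      exact pow_le_one₀ (abs_nonneg _) (Real.abs_cos_le_one φ))
    (fun φ => Real.hasSum_cos (z * Real.cos φ))
  rw [← h.tsum_eq, besselJ0, ← tsum_mul_left]
  refine tsum_congr fun k => ?_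
  simp only [mul_pow]
  rw [intervalIntegral.integral_div]
  simp_rw [← mul_assoc]
  rw [intervalIntegral.integral_const_mul, integral_cos_pow_even]
  have h1 : (k.factorial : ℝ) ≠ 0 := by positivity
  have h2 : ((2 * k).factorial : ℝ) ≠ 0 := by positivity
  rw [div_pow, pow_mul (2 : ℝ)]
  norm_num
  field_simp

theorem integral_sin_mul_cos_mul_cos (z : ℝ) :
    ∫ φ in (0 : ℝ)..Real.pi, Real.sin (z * Real.cos φ) * Real.cos φ =
      Real.pi * besselJ1 z := by
  have h := hasSum_integral_zero_pi
    (F := fun n φ => (-1) ^ n * (z * Real.cos φ) ^ (2 * n + 1) / (2 * n + 1).factorial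
      * Real.cos φ)
    (u := fun n => |(-1) ^ n * z ^ (2 * n + 1) / (2 * n + 1).factorial|)
    (fun n => by fun_prop) (Real.hasSum_sin z).summable.abs
    (fun n φ => by
      rw [show (-1) ^ n * (z * Real.cos φ) ^ (2 * n + 1) / ((2 * n + 1).factorial : ℝ)
          * Real.cos φ =
        (-1) ^ n * z ^ (2 * n + 1) / (2 * n + 1).factorial * Real.cos φ ^ (2 * n + 2) by ring,
        abs_mul]
      refine mul_le_of_le_one_right (abs_nonneg _) ?_
      rw [abs_pow]
      exact pow_le_one₀ (abs_nonneg _) (Real.abs_cos_le_one φ))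
    (fun φ => (Real.hasSum_sin (z * Real.cos φ)).mul_right _)
  rw [← h.tsum_eq, besselJ1, ← tsum_mul_left]
  refine tsum_congr fun k => ?_
  have h0 : ∀ φ : ℝ, (-1) ^ k * (z * Real.cos φ) ^ (2 * k + 1) / ((2 * k + 1).factorial : ℝ)
      * Real.cos φ =
      (-1) ^ k * z ^ (2 * k + 1) / (2 * k + 1).factorial * Real.cos φ ^ (2 * (k + 1)) :=
    fun φ => by ring
  simp_rw [h0]
  rw [intervalIntegral.integral_const_mul, integral_cos_pow_even]
  have h1 : (k.factorial : ℝ) ≠ 0 := by positivity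
  have h2 : ((2 * k + 1).factorial : ℝ) ≠ 0 := by positivity
  rw [div_pow, pow_succ (2 : ℝ), pow_mul (2 : ℝ), show 2 * (k + 1) = 2 * k + 1 + 1 by ring,
    Nat.factorial_succ (2 * k + 1), Nat.factorial_succ k]
  push_cast
  norm_num
  field_simp
  ring

/-- Differentiation under the integral sign over `[0, π]`. -/
theorem hasDerivAt_integral_zero_pi {F F' : ℝ → ℝ → ℝ} (hF : ∀ z, Continuous (F z))
    (hF' : ∀ z, Continuous (F' z)) (hb : ∀ z φ, |F' z φ| ≤ 1)
    (hd : ∀ z φ, HasDerivAt (fun z => F z φ) (F' z φ) z) (z : ℝ) :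
    HasDerivAt (fun z => ∫ φ in (0 : ℝ)..Real.pi, F z φ)
      (∫ φ in (0 : ℝ)..Real.pi, F' z φ) z := by
  refine (intervalIntegral.hasDerivAt_integral_of_dominated_loc_of_deriv_le
    (bound := fun _ => 1) (s := univ) univ_mem ?_ ?_ ?_ ?_ ?_ ?_).2
  · exact Eventually.of_forall fun z => (hF z).aestronglyMeasurable
  · exact (hF z).intervalIntegrable _ _
  · exact (hF' z).aestronglyMeasurable
  · exact ae_of_all _ fun φ _ z _ => hb z φ
  · exact intervalIntegrable_const
  · exact ae_of_all _ fun φ _ z _ => hd z φ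

theorem hasDerivAt_besselJ0 (z : ℝ) : HasDerivAt besselJ0 (-besselJ1 z) z := by
  have h := hasDerivAt_integral_zero_pi (F := fun z φ => Real.cos (z * Real.cos φ))
    (F' := fun z φ => -(Real.sin (z * Real.cos φ) * Real.cos φ))
    (fun z => by fun_prop) (fun z => by fun_prop)
    (fun z φ => by
      rw [abs_neg, abs_mul]
      exact mul_le_one₀ (Real.abs_sin_le_one _) (abs_nonneg _) (Real.abs_cos_le_one _))
    (fun z φ => by
      refine hasDerivAt_of_forall_eq ((hasDerivAt_id z).mul_const (Real.cos φ)).cos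
        (fun _ => rfl) ?_
      simp) z
  simp only [integral_cos_mul_cos, intervalIntegral.integral_neg,
    integral_sin_mul_cos_mul_cos] at h
  refine hasDerivAt_of_forall_eq (h.const_mul Real.pi⁻¹) (fun z => ?_) ?_
  · field_simp
  · field_simp

theorem hasDerivAt_mul_besselJ1 (z : ℝ) :
    HasDerivAt (fun z => z * besselJ1 z) (z * besselJ0 z) z := by
  have h := hasDerivAt_integral_zero_pi (F := fun z φ => Real.sin (z * Real.cos φ) * Real.cos φ)
    (F' := fun z φ => Real.cos (z * Real.cos φ) * Real.cos φ * Real.cos φ)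
    (fun z => by fun_prop) (fun z => by fun_prop)
    (fun z φ => by
      rw [abs_mul, abs_mul]
      exact mul_le_one₀ (mul_le_one₀ (Real.abs_cos_le_one _) (abs_nonneg _)
        (Real.abs_cos_le_one _)) (abs_nonneg _) (Real.abs_cos_le_one _))
    (fun z φ => by
      refine hasDerivAt_of_forall_eq
        ((((hasDerivAt_id z).mul_const (Real.cos φ)).sin).mul_const (Real.cos φ)) (fun _ => rfl) ?_
      simp) z
  have hparts : ∫ φ in (0 : ℝ)..Real.pi, (Real.sin (z * Real.cos φ) * Real.cos φ +
      z * (Real.cos (z * Real.cos φ) * Real.cos φ * Real.cos φ) -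
        z * Real.cos (z * Real.cos φ)) = 0 := by
    rw [intervalIntegral.integral_eq_sub_of_hasDerivAt
      (f := fun φ => Real.sin φ * Real.sin (z * Real.cos φ))]
    · simp
    · intro φ _
      refine hasDerivAt_of_forall_eq
        ((Real.hasDerivAt_sin φ).mul (((Real.hasDerivAt_cos φ).const_mul z).sin))
        (fun _ => rfl) ?_
      have := Real.sin_sq_add_cos_sq φ
      linear_combination (z * Real.cos (z * Real.cos φ)) * this
    · exact Continuous.intervalIntegrable (by fun_prop) _ _
  rw [intervalIntegral.integral_sub, intervalIntegral.integral_add,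
    intervalIntegral.integral_const_mul, intervalIntegral.integral_const_mul,
    integral_cos_mul_cos, integral_sin_mul_cos_mul_cos] at hparts
  rotate_left
  iterate 4 exact Continuous.intervalIntegrable (by fun_prop) _ _
  simp only [integral_sin_mul_cos_mul_cos] at h
  refine hasDerivAt_of_forall_eq ((hasDerivAt_id z).mul (h.const_mul Real.pi⁻¹))
    (fun z => ?_) ?_
  · simp only [id, Pi.mul_apply]
    field_simp
  · simp only [id]
    have hpi : Real.pi⁻¹ * Real.pi = 1 := inv_mul_cancel₀ Real.pi_ne_zero
    linear_combination (-Real.pi⁻¹) * hparts - z * besselJ0 z * hpi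

/-! ### The sine integral -/

theorem sineIntegral_eq_integral_sinc (x : ℝ) :
    sineIntegral x = ∫ t in (0 : ℝ)..x, Real.sinc t := by
  refine intervalIntegral.integral_congr_ae ?_
  filter_upwards [compl_mem_ae_iff.mpr (measure_singleton (0 : ℝ))] with t ht _
  exact (Real.sinc_of_ne_zero ht).symm

theorem hasDerivAt_sineIntegral (x : ℝ) : HasDerivAt sineIntegral (Real.sinc x) x := by
  rw [funext sineIntegral_eq_integral_sinc]
  exact (Real.continuous_sinc.integral_hasStrictDerivAt 0 x).hasDerivAt

theorem continuous_sineIntegral : Continuous sineIntegral :=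
  continuous_iff_continuousAt.mpr fun x => (hasDerivAt_sineIntegral x).continuousAt

theorem abs_sineIntegral_le (x : ℝ) : |sineIntegral x| ≤ |x| := by
  rw [sineIntegral_eq_integral_sinc]
  simpa using intervalIntegral.norm_integral_le_of_norm_le_const (a := 0) (b := x) (C := 1)
    (f := Real.sinc) fun t _ => Real.abs_sinc_le_one t

/-! ### Integrals against the Cauchy weight -/

theorem continuous_inv_one_add_sq : Continuous fun s : ℝ => (1 + s ^ 2)⁻¹ :=
  Continuous.inv₀ (by fun_prop) fun s => by positivity

/-- The half-angle substitution `φ = 2 arctan s`. -/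
theorem integral_Ioi_inv_one_add_sq_mul {g : ℝ → ℝ} (hg : Continuous g)
    (hgb : ∀ x, |g x| ≤ 1) :
    ∫ s in Ioi (0 : ℝ), (1 + s ^ 2)⁻¹ * g (2 * Real.arctan s) =
      (∫ φ in (0 : ℝ)..Real.pi, g φ) / 2 := by
  set G : ℝ → ℝ := fun x => ∫ φ in (0 : ℝ)..x, g φ
  have hG : ∀ x, HasDerivAt G (g x) x := fun x => (hg.integral_hasStrictDerivAt 0 x).hasDerivAt
  have hGc : Continuous G := continuous_iff_continuousAt.mpr fun x => (hG x).continuousAt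
  have hd : ∀ s : ℝ, HasDerivAt (fun s => G (2 * Real.arctan s) / 2)
      ((1 + s ^ 2)⁻¹ * g (2 * Real.arctan s)) s := fun s => by
    refine hasDerivAt_of_forall_eq
      (((hG (2 * Real.arctan s)).comp s ((Real.hasDerivAt_arctan s).const_mul 2)).div_const 2)
      (fun _ => rfl) ?_
    ring
  rw [integral_Ioi_of_hasDerivAt_of_tendsto (hd 0).continuousAt.continuousWithinAt
    (fun s _ => hd s) ?_ (m := G Real.pi / 2)]
  · simp [G]
  · have h := (Real.tendsto_arctan_atTop.mono_right nhdsWithin_le_nhds).const_mul 2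
    rw [mul_div_cancel₀ _ two_ne_zero] at h
    exact ((hGc.tendsto _).comp h).div_const 2
  · refine Integrable.mono' integrable_inv_one_add_sq.integrableOn
      (continuous_inv_one_add_sq.mul (by fun_prop)).aestronglyMeasurable
      (ae_of_all _ fun s => ?_)
    have h : 0 < (1 + s ^ 2)⁻¹ := by positivity
    rw [Real.norm_eq_abs, abs_mul, abs_of_pos h]
    exact mul_le_of_le_one_right h.le (hgb _)

theorem integral_cos_mul_inv_one_add_sq (z : ℝ) :
    ∫ s in Ioi (0 : ℝ), (1 + s ^ 2)⁻¹ * Real.cos (2 * z * (1 + s ^ 2)⁻¹) =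
      Real.pi / 2 * (Real.cos z * besselJ0 z) := by
  have h := integral_Ioi_inv_one_add_sq_mul (g := fun φ => Real.cos (z * (1 + Real.cos φ)))
    (by fun_prop) (fun _ => Real.abs_cos_le_one _)
  have hcos : ∀ s : ℝ, z * (1 + Real.cos (2 * Real.arctan s)) = 2 * z * (1 + s ^ 2)⁻¹ := by
    intro s
    rw [Real.cos_two_mul, Real.cos_sq_arctan]
    ring
  simp only [hcos] at h
  rw [h]
  have hodd : ∫ φ in (0 : ℝ)..Real.pi, Real.sin (z * Real.cos φ) = 0 := by
    have := intervalIntegral.integral_comp_sub_left (a := 0) (b := Real.pi)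
      (fun φ => Real.sin (z * Real.cos φ)) Real.pi
    simp only [Real.cos_pi_sub, mul_neg, Real.sin_neg, sub_self, sub_zero,
      intervalIntegral.integral_neg] at this
    linarith
  simp only [mul_add, mul_one, Real.cos_add]
  rw [intervalIntegral.integral_sub, intervalIntegral.integral_const_mul,
    intervalIntegral.integral_const_mul, hodd, integral_cos_mul_cos]
  · ring
  all_goals exact Continuous.intervalIntegrable (by fun_prop) _ _

/-- Differentiation in `t` of integrals of `f (t / (1 + s ^ 2))` over the half-line. -/
theorem hasDerivAt_integral_comp_mul_inv_one_add_sq {f f' : ℝ → ℝ}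
    (hf : ∀ x, HasDerivAt f (f' x) x) (hf' : Continuous f') (hfb : ∀ x, |f x| ≤ |x|)
    (hfb' : ∀ x, |f' x| ≤ 1) (t : ℝ) :
    HasDerivAt (fun t => ∫ s in Ioi (0 : ℝ), f (t * (1 + s ^ 2)⁻¹))
      (∫ s in Ioi (0 : ℝ), (1 + s ^ 2)⁻¹ * f' (t * (1 + s ^ 2)⁻¹)) t := by
  have hfc : Continuous f := continuous_iff_continuousAt.mpr fun x => (hf x).continuousAt
  have hw := continuous_inv_one_add_sq
  have hpos : ∀ s : ℝ, 0 < (1 + s ^ 2)⁻¹ := fun s => by positivity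
  refine (hasDerivAt_integral_of_dominated_loc_of_deriv_le
    (bound := fun s => (1 + s ^ 2)⁻¹) (s := univ)
    (F' := fun t s => (1 + s ^ 2)⁻¹ * f' (t * (1 + s ^ 2)⁻¹))
    univ_mem ?_ ?_ ?_ ?_ ?_ ?_).2
  · exact Eventually.of_forall fun t =>
      (hfc.comp (continuous_const.mul hw)).aestronglyMeasurable
  · refine Integrable.mono' (integrable_inv_one_add_sq.const_mul |t|).integrableOn
      (hfc.comp (continuous_const.mul hw)).aestronglyMeasurable (ae_of_all _ fun s => ?_)
    refine (hfb _).trans_eq ?_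
    rw [abs_mul, abs_of_pos (hpos s)]
  · exact (hw.mul (hf'.comp (continuous_const.mul hw))).aestronglyMeasurable
  · refine ae_of_all _ fun s t _ => ?_
    rw [Real.norm_eq_abs, abs_mul, abs_of_pos (hpos s)]
    exact mul_le_of_le_one_right (hpos s).le (hfb' _)
  · exact integrable_inv_one_add_sq.integrableOn
  · refine ae_of_all _ fun s t _ => ?_
    refine hasDerivAt_of_forall_eq
      ((hf (t * (1 + s ^ 2)⁻¹)).comp t ((hasDerivAt_id t).mul_const _)) (fun _ => rfl) ?_
    simp [mul_comm]

theorem integral_sin_mul_inv_one_add_sq (z : ℝ) :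
    ∫ s in Ioi (0 : ℝ), Real.sin (2 * z * (1 + s ^ 2)⁻¹) =
      Real.pi * (z * (Real.cos z * besselJ0 z + Real.sin z * besselJ1 z)) := by
  refine eq_of_hasDerivAt_eq (f' := fun z => Real.pi * (Real.cos z * besselJ0 z))
    (f := fun z => ∫ s in Ioi (0 : ℝ), Real.sin (2 * z * (1 + s ^ 2)⁻¹))
    (g := fun z => Real.pi * (z * (Real.cos z * besselJ0 z + Real.sin z * besselJ1 z)))
    (fun z => ?_) (fun z => ?_) (by simp) z
  · have h := hasDerivAt_integral_comp_mul_inv_one_add_sq Real.hasDerivAt_sin Real.continuous_cos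
      (fun x => Real.abs_sin_le_abs) Real.abs_cos_le_one (2 * z)
    rw [integral_cos_mul_inv_one_add_sq] at h
    refine hasDerivAt_of_forall_eq (h.comp z ((hasDerivAt_id z).const_mul 2)) (fun _ => rfl) ?_
    ring
  · have h := (((Real.hasDerivAt_cos z).mul ((hasDerivAt_id z).mul (hasDerivAt_besselJ0 z))).add
      ((Real.hasDerivAt_sin z).mul (hasDerivAt_mul_besselJ1 z))).const_mul Real.pi
    refine hasDerivAt_of_forall_eq h (fun z => ?_) ?_
    · simp only [Pi.add_apply, Pi.mul_apply, id]
      ring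
    · simp only [Pi.mul_apply, id]
      ring

theorem integral_sineIntegral_mul_inv_one_add_sq (z : ℝ) :
    ∫ s in Ioi (0 : ℝ), sineIntegral (2 * z * (1 + s ^ 2)⁻¹) =
      Real.pi * ((2 * z * Real.cos z - Real.sin z) * besselJ0 z +
        2 * z * Real.sin z * besselJ1 z) := by
  refine eq_of_hasDerivAt_eq
    (f' := fun z => Real.pi * (Real.cos z * besselJ0 z + Real.sin z * besselJ1 z))
    (f := fun z => ∫ s in Ioi (0 : ℝ), sineIntegral (2 * z * (1 + s ^ 2)⁻¹))
    (g := fun z => Real.pi * ((2 * z * Real.cos z - Real.sin z) * besselJ0 z +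
        2 * z * Real.sin z * besselJ1 z))
    (fun z => ?_) (fun z => ?_) (by simp [sineIntegral]) z
  · have h := hasDerivAt_integral_comp_mul_inv_one_add_sq hasDerivAt_sineIntegral
      Real.continuous_sinc abs_sineIntegral_le Real.abs_sinc_le_one (2 * z)
    refine hasDerivAt_of_forall_eq (h.comp z ((hasDerivAt_id z).const_mul 2)) (fun _ => rfl) ?_
    rcases eq_or_ne z 0 with rfl | hz
    · have hJ : besselJ0 0 = 1 := by
        rw [besselJ0, tsum_eq_single 0 fun k hk => by simp [hk]]
        simp
      simp [integral_Ioi_inv_one_add_sq, hJ]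
    · have hs : ∀ s : ℝ, (1 + s ^ 2)⁻¹ * Real.sinc (2 * z * (1 + s ^ 2)⁻¹) =
          (2 * z)⁻¹ * Real.sin (2 * z * (1 + s ^ 2)⁻¹) := fun s => by
        have : (1 + s ^ 2) ≠ 0 := by positivity
        rw [Real.sinc_of_ne_zero (by positivity)]
        field_simp
      simp_rw [hs]
      rw [integral_const_mul, integral_sin_mul_inv_one_add_sq]
      field_simp
  · have h := (((((hasDerivAt_id z).const_mul 2).mul (Real.hasDerivAt_cos z)).sub
      (Real.hasDerivAt_sin z)).mul (hasDerivAt_besselJ0 z)).add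
      (((Real.hasDerivAt_sin z).const_mul 2).mul (hasDerivAt_mul_besselJ1 z)) |>.const_mul Real.pi
    refine hasDerivAt_of_forall_eq h (fun z => ?_) ?_
    · simp only [Pi.add_apply, Pi.mul_apply, Pi.sub_apply, id]
      ring
    · simp only [Pi.mul_apply, Pi.sub_apply, id]
      ring

/-! ### The Cauchy–Schlömilch transformation -/

theorem hasDerivAt_sub_inv {x : ℝ} (hx : 0 < x) :
    HasDerivAt (fun x : ℝ => x - x⁻¹) (1 + (x ^ 2)⁻¹) x := by
  refine hasDerivAt_of_forall_eq ((hasDerivAt_id x).sub (hasDerivAt_inv hx.ne'))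
    (fun _ => rfl) ?_
  ring

theorem injOn_sub_inv : InjOn (fun x : ℝ => x - x⁻¹) (Ioi 0) := by
  intro x (hx : 0 < x) y (hy : 0 < y) h
  have h1 : (x - y) * (1 + x * y) = 0 := by
    simp only at h
    field_simp at h
    linear_combination h
  rcases mul_eq_zero.mp h1 with h2 | h2
  · linarith
  · nlinarith [mul_pos hx hy]

theorem image_sub_inv : (fun x : ℝ => x - x⁻¹) '' Ioi 0 = univ := by
  refine eq_univ_of_forall fun y => ?_
  have hs : Real.sqrt (y ^ 2 + 4) ^ 2 = y ^ 2 + 4 := Real.sq_sqrt (by positivity)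
  have hlt : |y| < Real.sqrt (y ^ 2 + 4) := by
    rw [← Real.sqrt_sq_eq_abs]
    exact Real.sqrt_lt_sqrt (sq_nonneg y) (by linarith)
  have hpos : 0 < y + Real.sqrt (y ^ 2 + 4) := by linarith [neg_abs_le y]
  refine ⟨(y + Real.sqrt (y ^ 2 + 4)) / 2, half_pos hpos, ?_⟩
  simp only
  field_simp
  linear_combination hs

theorem integral_Ioi_comp_sub_inv_s16 {f : ℝ → ℝ} (hfc : Continuous f) (hf : Integrable f)
    (heven : ∀ y, f (-y) = f y) :
    ∫ x in Ioi (0 : ℝ), f (x - x⁻¹) = ∫ y in Ioi (0 : ℝ), f y := by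
  have hder : ∀ x ∈ Ioi (0 : ℝ),
      HasDerivWithinAt (fun x : ℝ => x - x⁻¹) (1 + (x ^ 2)⁻¹) (Ioi 0) x :=
    fun x hx => (hasDerivAt_sub_inv hx).hasDerivWithinAt
  have hpos : ∀ x : ℝ, 0 < 1 + (x ^ 2)⁻¹ := fun x => by positivity
  have hint := (integrableOn_image_iff_integrableOn_abs_deriv_smul measurableSet_Ioi hder
    injOn_sub_inv f).mp (by rw [image_sub_inv]; exact hf.integrableOn)
  have hcv := integral_image_eq_integral_abs_deriv_smul measurableSet_Ioi hder injOn_sub_inv f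
  simp only [abs_of_pos (hpos _), smul_eq_mul] at hint hcv
  have hint' : IntegrableOn (fun x => f (x - x⁻¹)) (Ioi 0) := by
    refine Integrable.mono hint ?_ (ae_of_all _ fun x => ?_)
    · refine (hfc.comp_continuousOn ?_).aestronglyMeasurable measurableSet_Ioi
      exact fun x hx => (hder x hx).continuousWithinAt
    · rw [norm_mul]
      refine le_mul_of_one_le_left (norm_nonneg _) ?_
      rw [Real.norm_eq_abs, abs_of_pos (hpos x)]
      exact le_add_of_nonneg_right (by positivity)
  have hinv : ∫ x in Ioi (0 : ℝ), (x ^ 2)⁻¹ * f (x - x⁻¹) = ∫ x in Ioi (0 : ℝ), f (x - x⁻¹) := by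
    rw [← integral_comp_rpow_Ioi (fun x => f (x - x⁻¹)) (p := -1) (by norm_num)]
    refine setIntegral_congr_fun measurableSet_Ioi fun x (hx : 0 < x) => ?_
    simp only [Real.rpow_neg_one, inv_inv, smul_eq_mul]
    rw [← neg_sub x x⁻¹, heven, show (-1 - 1 : ℝ) = -(2 : ℕ) by norm_num,
      Real.rpow_neg hx.le, Real.rpow_natCast]
    simp
  have hint'' : IntegrableOn (fun x => (x ^ 2)⁻¹ * f (x - x⁻¹)) (Ioi 0) := by
    refine (hint.sub hint').congr (ae_of_all _ fun x => ?_)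
    simp only [Pi.sub_apply]
    ring
  have hsymm : ∫ y, f y = 2 * ∫ y in Ioi (0 : ℝ), f y := by
    rw [← integral_comp_abs]
    refine integral_congr_ae (ae_of_all _ fun y => ?_)
    rcases abs_choice y with h | h <;> simp only [h, heven]
  rw [image_sub_inv, setIntegral_univ, hsymm] at hcv
  simp only [add_mul, one_mul] at hcv
  rw [integral_add hint' hint'', hinv] at hcv
  linarith

theorem integral_Si_rational_eq_bessel (a b : ℝ) (ha : -1 < a) (hb : 0 < b)
    (c : ℝ) (hc : c = b / (8 * (1 + a))) :
    ∫ x in Set.Ioi (0 : ℝ),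
        sineIntegral (b * x ^ 2 / (x ^ 4 + 2 * a * x ^ 2 + 1)) =
      Real.pi * Real.sqrt (2 * (1 + a)) *
        ((4 * c * Real.cos (2 * c) - Real.sin (2 * c)) * besselJ0 (2 * c) +
          4 * c * Real.sin (2 * c) * besselJ1 (2 * c)) := by
  have ha' : 0 < 1 + a := by linarith
  set r := Real.sqrt (2 * (1 + a)) with hr
  have hr2 : r ^ 2 = 2 * (1 + a) := Real.sq_sqrt (by positivity)
  have hr0 : 0 < r := Real.sqrt_pos.mpr (by positivity)
  have hcr : b = 2 * (2 * c) * r ^ 2 := by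
    rw [hc, hr2]
    field_simp
    norm_num
  set f : ℝ → ℝ := fun y => sineIntegral (2 * (2 * c) * (1 + (r⁻¹ * y) ^ 2)⁻¹) with hf
  have hfc : Continuous f := continuous_sineIntegral.comp
    (continuous_const.mul (continuous_inv_one_add_sq.comp (by fun_prop)))
  have hfi : Integrable f := by
    refine Integrable.mono' (((integrable_inv_one_add_sq.comp_mul_left'
      (inv_ne_zero hr0.ne')).const_mul |2 * (2 * c)|)) hfc.aestronglyMeasurable
      (ae_of_all _ fun y => ?_)
    refine (abs_sineIntegral_le _).trans_eq ?_
    have : 0 < (1 + (r⁻¹ * y) ^ 2)⁻¹ := by positivity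
    rw [abs_mul, abs_of_pos this]
  have hrw : ∀ x ∈ Ioi (0 : ℝ),
      sineIntegral (b * x ^ 2 / (x ^ 4 + 2 * a * x ^ 2 + 1)) = f (x - x⁻¹) := by
    intro x (hx : 0 < x)
    have hden : x ^ 4 + 2 * a * x ^ 2 + 1 = (x ^ 2 - 1) ^ 2 + r ^ 2 * x ^ 2 := by
      rw [hr2]
      ring
    rw [hf, hden, hcr]
    have h1 : 0 < (x ^ 2 - 1) ^ 2 + r ^ 2 * x ^ 2 := by positivity
    have h2 : 1 + (r⁻¹ * (x - x⁻¹)) ^ 2 =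
        ((x ^ 2 - 1) ^ 2 + r ^ 2 * x ^ 2) / (r ^ 2 * x ^ 2) := by
      field_simp
      ring
    simp only [h2, inv_div]
    congr 1
    ring
  rw [setIntegral_congr_fun measurableSet_Ioi hrw,
    integral_Ioi_comp_sub_inv_s16 hfc hfi fun y => by simp [hf], hf,
    integral_comp_mul_left_Ioi (fun s => sineIntegral (2 * (2 * c) * (1 + s ^ 2)⁻¹)) 0
      (inv_pos.mpr hr0), mul_zero, integral_sineIntegral_mul_inv_one_add_sq, inv_inv, smul_eq_mul]
  ring
end

section
/- For every real number s > 1, ∫₀^∞ x^{2s+1} / cosh²(x²) dx = 2^{−s} · (1 − 2^{1−s}) · Γ(s+1) · ζ(s). -/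
open MeasureTheory

theorem summable_add_one_rpow_neg {s : ℝ} (hs : 1 < s) :
    Summable fun n : ℕ ↦ ((n : ℝ) + 1) ^ (-s) := by
  have h := (summable_nat_add_iff 1).2 (Real.summable_nat_rpow.2 (neg_lt_neg hs))
  simpa using h

/-- The Dirichlet eta series in terms of the zeta series. -/
theorem hasSum_neg_one_pow_mul_add_one_rpow_neg {s : ℝ} (hs : 1 < s) :
    HasSum (fun n : ℕ ↦ (-1 : ℝ) ^ n * ((n : ℝ) + 1) ^ (-s))
      ((1 - (2 : ℝ) ^ (1 - s)) * ∑' n : ℕ, ((n : ℝ) + 1) ^ (-s)) := by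
  set f : ℕ → ℝ := fun n ↦ ((n : ℝ) + 1) ^ (-s) with hf
  have hsum : Summable f := summable_add_one_rpow_neg hs
  have hodd : HasSum (fun n ↦ f (2 * n + 1)) ((2 : ℝ) ^ (-s) * ∑' n, f n) := by
    convert! hsum.hasSum.mul_left ((2 : ℝ) ^ (-s)) using 2 with n
    rw [hf, ← Real.mul_rpow (by norm_num) (by positivity)]
    push_cast
    ring_nf
  have heven : HasSum (fun n ↦ f (2 * n)) (∑' n, f (2 * n)) :=
    (hsum.comp_injective (mul_right_injective₀ (two_ne_zero' ℕ))).hasSum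
  have hZ := (heven.even_add_odd hodd).unique hsum.hasSum
  have htwo : (2 : ℝ) ^ (1 - s) = 2 * (2 : ℝ) ^ (-s) := by
    rw [sub_eq_add_neg, Real.rpow_add two_pos, Real.rpow_one]
  have hval : (1 - (2 : ℝ) ^ (1 - s)) * ∑' n, f n =
      ∑' n, f (2 * n) + -((2 : ℝ) ^ (-s) * ∑' n, f n) := by
    rw [htwo]
    linear_combination -hZ
  rw [hval]
  refine HasSum.even_add_odd ?_ ?_
  · simpa [pow_mul, hf] using heven
  · simpa [pow_succ, pow_mul, hf] using hodd.neg

theorem hasSum_add_one_mul_pow_succ {r : ℝ} (hr : ‖r‖ < 1) :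
    HasSum (fun n : ℕ ↦ ((n : ℝ) + 1) * r ^ (n + 1)) (r / (1 - r) ^ 2) := by
  have h : HasSum (fun n : ℕ ↦ (n : ℝ) * r ^ n) (r / (1 - r) ^ 2) :=
    hasSum_coe_mul_geometric_of_norm_lt_one hr
  rw [← hasSum_nat_add_iff' 1] at h
  simpa using h

theorem one_div_cosh_sq_eq (t : ℝ) :
    1 / Real.cosh t ^ 2 = 4 * (Real.exp (-(2 * t)) / (1 + Real.exp (-(2 * t))) ^ 2) := by
  have hexp : Real.exp (-(2 * t)) = Real.exp (-t) ^ 2 := by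
    rw [sq, ← Real.exp_add]
    ring_nf
  have hmul : Real.exp t * Real.exp (-t) = 1 := by
    rw [← Real.exp_add, add_neg_cancel, Real.exp_zero]
  have hcosh : 1 + Real.exp (-t) ^ 2 = Real.exp (-t) * (2 * Real.cosh t) := by
    rw [Real.cosh_eq]
    linear_combination -hmul
  have hneg := (Real.exp_pos (-t)).ne'
  have hc := (Real.cosh_pos t).ne'
  rw [hexp, hcosh]
  field_simp
  norm_num

theorem hasSum_one_div_cosh_sq {t : ℝ} (ht : 0 < t) :
    HasSum (fun n : ℕ ↦ 4 * (-1 : ℝ) ^ n * ((n : ℝ) + 1) * Real.exp (-(2 * ((n : ℝ) + 1)) * t))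
      (1 / Real.cosh t ^ 2) := by
  have hnorm : ‖-Real.exp (-(2 * t))‖ < 1 := by
    rw [norm_neg, Real.norm_eq_abs, Real.abs_exp, Real.exp_lt_one_iff]
    linarith
  have h := (hasSum_add_one_mul_pow_succ hnorm).mul_left (-4)
  have hval : -4 * (-Real.exp (-(2 * t)) / (1 - -Real.exp (-(2 * t))) ^ 2) =
      1 / Real.cosh t ^ 2 := by
    rw [one_div_cosh_sq_eq, sub_neg_eq_add]
    ring
  rw [hval] at h
  refine h.congr_fun fun n ↦ ?_
  have hexp : Real.exp (-(2 * ((n : ℝ) + 1)) * t) = Real.exp (-(2 * t)) ^ (n + 1) := by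
    rw [← Real.exp_nat_mul]
    push_cast
    ring_nf
  rw [hexp, neg_pow (Real.exp _)]
  ring

theorem integral_rpow_div_cosh_sq_eq_zeta (s : ℝ) (hs : 1 < s) :
    ∫ x in Set.Ioi (0 : ℝ), x ^ (2 * s + 1) / Real.cosh (x ^ 2) ^ 2 =
      (2 : ℝ) ^ (-s) * (1 - (2 : ℝ) ^ (1 - s)) * Real.Gamma (s + 1) *
        ∑' n : ℕ, ((n : ℝ) + 1) ^ (-s) := by
  let g : ℕ → ℝ → ℝ := fun n x ↦
    x ^ (2 * s + 1) * Real.exp (-(2 * ((n : ℝ) + 1)) * x ^ (2 : ℝ))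
  let c : ℕ → ℝ := fun n ↦ 4 * (-1 : ℝ) ^ n * ((n : ℝ) + 1)
  have hg_int (n : ℕ) : IntegrableOn (g n) (Set.Ioi 0) :=
    integrableOn_rpow_mul_exp_neg_mul_rpow (by linarith) (by norm_num) (by positivity)
  have hg_val (n : ℕ) : 4 * ((n : ℝ) + 1) * ∫ x in Set.Ioi 0, g n x =
      (2 : ℝ) ^ (-s) * Real.Gamma (s + 1) * ((n : ℝ) + 1) ^ (-s) := by
    have hn : (0 : ℝ) < (n : ℝ) + 1 := by positivity
    have hq : (2 * s + 1 + 1) / 2 = s + 1 := by ring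
    have hq' : -(s + 1) = -s - 1 := by ring
    rw [integral_rpow_mul_exp_neg_mul_rpow two_pos (by linarith) (by positivity), neg_div, hq, hq',
      Real.mul_rpow two_pos.le hn.le, Real.rpow_sub_one two_ne_zero, Real.rpow_sub_one hn.ne']
    field_simp
    norm_num
  have hg_nonneg (n : ℕ) : ∀ x ∈ Set.Ioi (0 : ℝ), 0 ≤ g n x := fun x hx ↦
    mul_nonneg (Real.rpow_nonneg (le_of_lt hx) _) (Real.exp_pos _).le
  have hnorm (n : ℕ) : ∫ x in Set.Ioi 0, ‖c n * g n x‖ =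
      (2 : ℝ) ^ (-s) * Real.Gamma (s + 1) * ((n : ℝ) + 1) ^ (-s) := by
    rw [← hg_val, ← integral_const_mul]
    refine setIntegral_congr_fun measurableSet_Ioi fun x hx ↦ ?_
    have hn : (0 : ℝ) ≤ (n : ℝ) + 1 := by positivity
    simp [c, abs_of_nonneg (hg_nonneg n x hx), abs_of_nonneg hn]
  have hsum := hasSum_integral_of_summable_integral_norm
    (μ := volume.restrict (Set.Ioi 0)) (F := fun n x ↦ c n * g n x)
    (fun n ↦ (hg_int n).const_mul (c n))
    (by simpa only [hnorm] using (summable_add_one_rpow_neg hs).mul_left _)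
  have hint : ∫ x in Set.Ioi (0 : ℝ), x ^ (2 * s + 1) / Real.cosh (x ^ 2) ^ 2 =
      ∫ x in Set.Ioi (0 : ℝ), ∑' n, c n * g n x := by
    refine setIntegral_congr_fun measurableSet_Ioi fun x hx ↦ ?_
    have h := (hasSum_one_div_cosh_sq (sq_pos_of_pos hx)).mul_left (x ^ (2 * s + 1))
    rw [mul_one_div] at h
    refine h.tsum_eq.symm.trans (tsum_congr fun n ↦ ?_)
    simp only [c, g, Real.rpow_two]
    ring
  rw [hint]
  refine hsum.unique ?_
  convert! (hasSum_neg_one_pow_mul_add_one_rpow_neg hs).mul_left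
    ((2 : ℝ) ^ (-s) * Real.Gamma (s + 1)) using 1
  · funext n
    rw [integral_const_mul]
    simp only [c]
    linear_combination (-1 : ℝ) ^ n * hg_val n
  · ring
end
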